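/- Let 𝔾 be a toroidal grid diagram of grid number n with 4-fold diagram 𝔾₄. The endomorphism ∂₄• of GC•(𝔾₄) is homogeneous of degree (−1,0) with respect to the (Maslov, Alexander) bigrading and satisfies ∂₄• ∘ ∂₄• = 0. -/

import Mathlib

/-!
Combinatorial model of toroidal grid diagrams, their 4-fold covers, and the
double-point enhanced grid complex (over 𝔽 = ℤ/2ℤ), following Lipshitz and
Ozsváth–Szabó–Sarkar conventions.

* The torus is modelled by `ZMod n × ZMod n`: the horizontal circle `α_j` and
  vertical circle `β_k` meet at the point `(k, j)`; the square `(k, j)` is the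
  one with south-west corner at the point `(k, j)`;  the `O`- and `X`-markings
  of column `k` occupy squares `(k, Orow k)` and `(k, Xrow k)`.
* A grid state is a bijection (column ↦ row), i.e. a permutation of `ZMod n`.
* The 4-fold cover `𝔾₄` lives on `ZMod (2n) × ZMod (2n)`, with the covering
  map `pr` reducing coordinates mod `n`.  A grid state of `𝔾₄` is the preimage
  of a grid state of `𝔾`, so grid states of `𝔾₄` are canonically identified
  with grid states of `𝔾`; similarly the free module `GC` underlying both
  `GC•(𝔾)` and `GC•(𝔾₄)` is the same, and the identification `J₄` is the
  identity map.
* Rectangles are recorded by their two vertical circles (west/east) and two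
  horizontal circles (south/north); "rectangle from x₄ to y₄" is the boundary
  condition `∂(∂_α(r + Nr + Er + NEr)) = y₄ - x₄` (and the `∂_β` analogue),
  expressed via corner-point indicator functions.  Each `N,E`-equivalence class
  of rectangles in `𝔾₄` contains exactly one *normalized* representative
  (west circle and south circle in the first fundamental domain), so sums over
  equivalence classes are sums over normalized representatives.
-/

noncomputable section

open scoped Classical

namespace GridHomology

/-- the ground field `𝔽 = ℤ/2ℤ` -/
abbrev F : Type := ZMod 2

/-- A toroidal grid diagram of grid number `n`. -/
structure GridDiagram (n : ℕ) where
  Orow : ZMod n → ZMod n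
  Xrow : ZMod n → ZMod n
  hO : Function.Bijective Orow
  hX : Function.Bijective Xrow
  hOX : ∀ i, Orow i ≠ Xrow i

/-- A grid state: one point on each horizontal and each vertical circle. -/
abbrev GridState (n : ℕ) := Equiv.Perm (ZMod n)

instance twoMulNeZero (n : ℕ) [NeZero n] : NeZero (2 * n) :=
  ⟨fun h => NeZero.ne n (by omega)⟩

/-- membership in the cyclic (going east/north) interval `[u, v)` -/
def inIco {m : ℕ} (u v k : ZMod m) : Prop := (k - u).val < (v - u).val

/-- membership in the open cyclic interval `(u, v)` -/
def inIoo {m : ℕ} (u v k : ZMod m) : Prop :=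
  0 < (k - u).val ∧ (k - u).val < (v - u).val

instance {m : ℕ} (u v k : ZMod m) : Decidable (inIco u v k) :=
  inferInstanceAs (Decidable (_ < _))

instance {m : ℕ} (u v k : ZMod m) : Decidable (inIoo u v k) :=
  inferInstanceAs (Decidable (_ ∧ _))

/-- Rectangle data on the `m × m` torus: west and east vertical circles,
south and north horizontal circles. -/
structure Rect (m : ℕ) where
  cW : ZMod m
  cE : ZMod m
  rS : ZMod m
  rN : ZMod m
deriving DecidableEq

instance (m : ℕ) [NeZero m] : Fintype (Rect m) :=
  Fintype.ofEquiv (ZMod m × ZMod m × ZMod m × ZMod m)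
    { toFun := fun p => ⟨p.1, p.2.1, p.2.2.1, p.2.2.2⟩
      invFun := fun r => ⟨r.cW, r.cE, r.rS, r.rN⟩
      left_inv := fun _ => rfl
      right_inv := fun _ => rfl }

/-- local multiplicity of a rectangle at a square of the torus -/
def Rect.mult {m : ℕ} (r : Rect m) (sq : ZMod m × ZMod m) : ℕ :=
  if inIco r.cW r.cE sq.1 ∧ inIco r.rS r.rN sq.2 then 1 else 0

/-- `r` is an (embedded, not necessarily empty) rectangle from `x` to `y` in `𝔾`:
its south-west and north-east corners lie in `x`, its south-east and north-west
corners lie in `y`, and `x`, `y` agree away from the two vertical circles of `r`. -/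
def IsRectFrom {m : ℕ} (x y : GridState m) (r : Rect m) : Prop :=
  r.cW ≠ r.cE ∧ r.rS ≠ r.rN ∧
  x r.cW = r.rS ∧ x r.cE = r.rN ∧ y r.cW = r.rN ∧ y r.cE = r.rS ∧
  ∀ k, k ≠ r.cW → k ≠ r.cE → x k = y k

/-- point-measure of a rectangle in `𝔾` at a grid state `w`: the sum over the
points of `w` of the average of the four adjacent local multiplicities -/
def Rect.pm {m : ℕ} [NeZero m] (w : GridState m) (r : Rect m) : ℚ :=
  (∑ k : ZMod m, ((r.mult (k - 1, w k - 1) + r.mult (k, w k - 1) +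
      r.mult (k - 1, w k) + r.mult (k, w k) : ℕ) : ℚ)) / 4

/-- `m(r) = #(Int r ∩ x)` -/
def Rect.intCount {m : ℕ} [NeZero m] (x : GridState m) (r : Rect m) : ℕ :=
  (Finset.univ.filter fun k => inIoo r.cW r.cE k ∧ inIoo r.rS r.rN (x k)).card

/-- `O_i(r)` in `𝔾` -/
def Ocount {m : ℕ} (G : GridDiagram m) (r : Rect m) (i : ZMod m) : ℕ :=
  r.mult (i, G.Orow i)

/-- `X_i(r)` in `𝔾` -/
def Xcount {m : ℕ} (G : GridDiagram m) (r : Rect m) (i : ZMod m) : ℕ :=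
  r.mult (i, G.Xrow i)

/-- `r ∩ 𝕏 = ∅` -/
def XDisjoint {m : ℕ} (G : GridDiagram m) (r : Rect m) : Prop :=
  ∀ i, Xcount G r i = 0

/-! ### The 4-fold cover -/

/-- the covering projection `π₄ : 𝔾₄ → 𝔾` on coordinates -/
def pr {n : ℕ} (a : ZMod (2 * n)) : ZMod n :=
  ZMod.castHom (dvd_mul_left n 2) (ZMod n) a

/-- indicator function (as a formal sum of points) of the lifted grid state `x₄` -/
def stInd {n : ℕ} (x : GridState n) (p : ZMod (2 * n) × ZMod (2 * n)) : ℤ :=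
  if x (pr p.1) = pr p.2 then 1 else 0

/-- `∂(∂_α r)` as a formal sum of points: `SE + NW − SW − NE` -/
def cornerA {m : ℕ} (r : Rect m) (p : ZMod m × ZMod m) : ℤ :=
  (if p = (r.cE, r.rS) then 1 else 0) + (if p = (r.cW, r.rN) then 1 else 0)
    - (if p = (r.cW, r.rS) then 1 else 0) - (if p = (r.cE, r.rN) then 1 else 0)

/-- `∂(∂_β r)` as a formal sum of points: `NE + SW − SE − NW` -/
def cornerB {m : ℕ} (r : Rect m) (p : ZMod m × ZMod m) : ℤ :=
  (if p = (r.cE, r.rN) then 1 else 0) + (if p = (r.cW, r.rS) then 1 else 0)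
    - (if p = (r.cE, r.rS) then 1 else 0) - (if p = (r.cW, r.rN) then 1 else 0)

/-- northward translation `N` by `n` rows -/
def trN {n : ℕ} (r : Rect (2 * n)) : Rect (2 * n) :=
  ⟨r.cW, r.cE, r.rS + (n : ZMod (2 * n)), r.rN + (n : ZMod (2 * n))⟩

/-- eastward translation `E` by `n` columns -/
def trE {n : ℕ} (r : Rect (2 * n)) : Rect (2 * n) :=
  ⟨r.cW + (n : ZMod (2 * n)), r.cE + (n : ZMod (2 * n)), r.rS, r.rN⟩

/-- `r` is a rectangle from `x₄` to `y₄` in the 4-fold diagram `𝔾₄`: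
`∂(∂_α (r + Nr + Er + NEr)) = y₄ − x₄` and `∂(∂_β (r + Nr + Er + NEr)) = x₄ − y₄`. -/
def IsRect4From {n : ℕ} (x y : GridState n) (r : Rect (2 * n)) : Prop :=
  r.cW ≠ r.cE ∧ r.rS ≠ r.rN ∧
  (∀ p, cornerA r p + cornerA (trN r) p + cornerA (trE r) p + cornerA (trN (trE r)) p
      = stInd y p - stInd x p) ∧
  (∀ p, cornerB r p + cornerB (trN r) p + cornerB (trE r) p + cornerB (trN (trE r)) p
      = stInd x p - stInd y p)

/-- the canonical (normalized) representative of each `{r, Nr, Er, NEr}`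
equivalence class: west and south coordinates lie in the first fundamental domain -/
def normal4 {n : ℕ} (r : Rect (2 * n)) : Prop := r.cW.val < n ∧ r.rS.val < n

instance {n : ℕ} (r : Rect (2 * n)) : Decidable (normal4 r) :=
  inferInstanceAs (Decidable (_ ∧ _))

/-- `O_i[r₄]`: total multiplicity of `r₄` at the four lifts of `O_i` -/
def O4count {n : ℕ} [NeZero n] (G : GridDiagram n) (r : Rect (2 * n)) (i : ZMod n) : ℕ :=
  ∑ p : ZMod (2 * n) × ZMod (2 * n),
    if pr p.1 = i ∧ pr p.2 = G.Orow i then r.mult p else 0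

/-- `X_i[r₄]` -/
def X4count {n : ℕ} [NeZero n] (G : GridDiagram n) (r : Rect (2 * n)) (i : ZMod n) : ℕ :=
  ∑ p : ZMod (2 * n) × ZMod (2 * n),
    if pr p.1 = i ∧ pr p.2 = G.Xrow i then r.mult p else 0

/-- `r₄ ∩ π₄⁻¹(𝕏) = ∅` -/
def XDisjoint4 {n : ℕ} [NeZero n] (G : GridDiagram n) (r : Rect (2 * n)) : Prop :=
  ∀ i, X4count G r i = 0

/-- point-measure of a domain (an integer-valued multiplicity function on the
squares of `𝔾₄`) at the lifted grid state `w₄` -/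
def pm4 {n : ℕ} [NeZero n] (w : GridState n) (ψ : ZMod (2 * n) × ZMod (2 * n) → ℤ) : ℚ :=
  (∑ p : ZMod (2 * n) × ZMod (2 * n),
    if w (pr p.1) = pr p.2 then
      ((ψ (p.1 - 1, p.2 - 1) + ψ (p.1, p.2 - 1) + ψ (p.1 - 1, p.2) + ψ p : ℤ) : ℚ)
    else 0) / 4

/-- a rectangle of `𝔾₄` viewed as a domain -/
def Rect.dom4 {n : ℕ} (r : Rect (2 * n)) : ZMod (2 * n) × ZMod (2 * n) → ℤ :=
  fun p => (r.mult p : ℤ)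

/-- point-measure `p_{w₄}[r₄]` of a rectangle of `𝔾₄` -/
def rpm4 {n : ℕ} [NeZero n] (w : GridState n) (r : Rect (2 * n)) : ℚ :=
  pm4 w r.dom4

/-- `m[r₄] = (p_{x₄}[r₄] + p_{y₄}[r₄] − 1)/2`, as a rational number -/
def mQ4 {n : ℕ} [NeZero n] (x y : GridState n) (r : Rect (2 * n)) : ℚ :=
  (rpm4 x r + rpm4 y r - 1) / 2

/-- `m[r₄]` as a natural number (the exponent of `v`) -/
def m4 {n : ℕ} [NeZero n] (x y : GridState n) (r : Rect (2 * n)) : ℕ :=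
  (⌊mQ4 x y r⌋).toNat

/-! ### Maslov and Alexander gradings (via the planar counting function `J`) -/

/-- the points of a planar fundamental domain associated to `f`, in doubled
coordinates (grid states at even positions, markings at odd positions) -/
def ptsOf {m : ℕ} [NeZero m] (f : ZMod m → ZMod m) (off : ℕ) : Finset (ℕ × ℕ) :=
  Finset.univ.image fun k => (2 * k.val + off, 2 * (f k).val + off)

/-- `I(P,Q)`: pairs `(p,q)` with `q` strictly above and strictly to the right of `p` -/
def Icnt (P Q : Finset (ℕ × ℕ)) : ℕ :=
  ∑ p ∈ P, (Q.filter fun q => p.1 < q.1 ∧ p.2 < q.2).card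

/-- `J(P,Q) = (I(P,Q) + I(Q,P))/2` -/
def Jq (P Q : Finset (ℕ × ℕ)) : ℚ := ((Icnt P Q : ℚ) + (Icnt Q P : ℚ)) / 2

/-- the Maslov-type grading `J(x,x) − 2 J(x,P) + J(P,P) + 1` for markings `P` -/
def MaslovOf {m : ℕ} [NeZero m] (f : ZMod m → ZMod m) (x : GridState m) : ℚ :=
  Jq (ptsOf (⇑x) 0) (ptsOf (⇑x) 0) - 2 * Jq (ptsOf (⇑x) 0) (ptsOf f 1)
    + Jq (ptsOf f 1) (ptsOf f 1) + 1

/-- the Maslov grading `M(x) = M_𝕆(x)` -/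
def MaslovO {m : ℕ} [NeZero m] (G : GridDiagram m) (x : GridState m) : ℚ :=
  MaslovOf G.Orow x

/-- `M_𝕏(x)` -/
def MaslovX {m : ℕ} [NeZero m] (G : GridDiagram m) (x : GridState m) : ℚ :=
  MaslovOf G.Xrow x

/-- the Alexander grading `A(x) = (M_𝕆(x) − M_𝕏(x) − (n−1))/2` -/
def Alex {m : ℕ} [NeZero m] (G : GridDiagram m) (x : GridState m) : ℚ :=
  (MaslovO G x - MaslovX G x - ((m : ℚ) - 1)) / 2

/-! ### The double-point enhanced grid complex -/

/-- the ring `𝔽[V₁, …, V_n, v]`: `V_i = X (some i)`, `v = X none` -/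
abbrev Rng (n : ℕ) : Type := MvPolynomial (Option (ZMod n)) F

/-- the free `𝔽[V₁,…,V_n,v]`-module on the set of grid states; it underlies both
`GC•(𝔾)` and `GC•(𝔾₄)` (their grid states being canonically identified) -/
abbrev GC (n : ℕ) := GridState n →₀ Rng n

/-- the variable `V_i` -/
def Vv {n : ℕ} (i : ZMod n) : Rng n := MvPolynomial.X (some i)

/-- the double-point variable `v` -/
def vV {n : ℕ} : Rng n := MvPolynomial.X none

/-- the `𝔽[V₁,…,V_n,v]`-linear map determined by values on grid states -/
def basisMap {n : ℕ} (f : GridState n → GC n) : GC n →ₗ[Rng n] GC n :=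
  Finsupp.lsum (Rng n) fun x => LinearMap.toSpanSingleton (Rng n) (GC n) (f x)

/-- the weight `V₁^{O₁[r₄]} ⋯ V_n^{O_n[r₄]} v^{m[r₄]}` of a rectangle of `𝔾₄` -/
def wt4 {n : ℕ} [NeZero n] (G : GridDiagram n) (x y : GridState n) (r : Rect (2 * n)) :
    Rng n :=
  (∏ i : ZMod n, Vv i ^ O4count G r i) * vV ^ m4 x y r

/-- the differential `∂₄•` of `GC•(𝔾₄)`: counts `N,E`-equivalence classes of
rectangles (via their normalized representatives) disjoint from `π₄⁻¹(𝕏)` -/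
def diff4 {n : ℕ} [NeZero n] (G : GridDiagram n) : GC n →ₗ[Rng n] GC n :=
  basisMap fun x => ∑ y : GridState n,
    ∑ r ∈ Finset.univ.filter
        (fun r : Rect (2 * n) => IsRect4From x y r ∧ normal4 r ∧ XDisjoint4 G r),
      Finsupp.single y (wt4 G x y r)

/-- the weight of a rectangle of `𝔾` -/
def wtB {n : ℕ} [NeZero n] (G : GridDiagram n) (x : GridState n) (r : Rect n) : Rng n :=
  (∏ i : ZMod n, Vv i ^ Ocount G r i) * vV ^ Rect.intCount x r

/-- the differential `∂•` of the double-point enhanced grid complex `GC•(𝔾)` -/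
def diffB {n : ℕ} [NeZero n] (G : GridDiagram n) : GC n →ₗ[Rng n] GC n :=
  basisMap fun x => ∑ y : GridState n,
    ∑ r ∈ Finset.univ.filter
        (fun r : Rect n => IsRectFrom x y r ∧ XDisjoint G r),
      Finsupp.single y (wtB G x r)

/-- `z` is homogeneous of bidegree `(d, s)` for the (Maslov, Alexander) bigrading
extended by `M(V₁^{k₁}⋯V_n^{k_n} v^m ⋅ x) = M(x) − 2Σkᵢ + 2m`,
`A(V₁^{k₁}⋯V_n^{k_n} v^m ⋅ x) = A(x) − Σkᵢ`. -/
def IsHomog {n : ℕ} [NeZero n] (G : GridDiagram n) (z : GC n) (d s : ℚ) : Prop :=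
  ∀ (y : GridState n) (k : Option (ZMod n) →₀ ℕ), MvPolynomial.coeff k (z y) ≠ 0 →
    (MaslovO G y - 2 * ∑ i : ZMod n, (k (some i) : ℚ) + 2 * (k none : ℚ) = d) ∧
    (Alex G y - ∑ i : ZMod n, (k (some i) : ℚ) = s)

/-- a linear map is homogeneous of degree `(a, b)` -/
def MapHomog {n : ℕ} [NeZero n] (G G' : GridDiagram n) (φ : GC n →ₗ[Rng n] GC n)
    (a b : ℚ) : Prop :=
  ∀ z d s, IsHomog G z d s → IsHomog G' (φ z) (d + a) (s + b)

/-- `𝔾` represents a knot: following the link (column `i` joins its `O` to the `X`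
in the same row, etc.) visits every column -/
def IsKnot {n : ℕ} (G : GridDiagram n) : Prop :=
  ∀ i j : ZMod n, ∃ k : ℕ,
    (((Equiv.ofBijective G.Orow G.hO).trans (Equiv.ofBijective G.Xrow G.hX).symm) ^ k) i = j

/-- the homotopy operator `𝓗_{X_j}•` counting equivalence classes of rectangles in
`𝔾₄` crossing the lifts of `X_j` exactly once and no other `X`-marking -/
def HXmap {n : ℕ} [NeZero n] (G : GridDiagram n) (j : ZMod n) : GC n →ₗ[Rng n] GC n :=
  basisMap fun x => ∑ y : GridState n,
    ∑ r ∈ Finset.univ.filter (fun r : Rect (2 * n) =>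
        IsRect4From x y r ∧ normal4 r ∧ X4count G r j = 1 ∧
        ∀ k, k ≠ j → X4count G r k = 0),
      Finsupp.single y (wt4 G x y r)

/-! ### Commutation moves, pentagons and hexagons

`𝔾` and `𝔾'` differ by commuting the (adjacent) columns `c−1` and `c`; they are
drawn on a common torus, sharing all markings and all circles except that the
vertical circle `β_c` of `𝔾` is replaced in `𝔾'` by a curve `γ_c` which passes
to the west of the marking line within the rows of the cyclic interval
`J = [h₁, h₂)` (which contains the markings of column `c−1`) and to the east of
it in the complementary rows (which contain the markings of column `c`);
`γ_c` crosses `β_c` at two points `a` (just south of the row-circle `h₂`) and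
`b` (just south of `h₁`).  Grid states of `𝔾'` are again recorded as
permutations (the `γ`-point in row `j` replacing the `β_c`-point). -/

structure CommData (n : ℕ) where
  G : GridDiagram n
  G' : GridDiagram n
  c : ZMod n
  h₁ : ZMod n
  h₂ : ZMod n
  hne : h₁ ≠ h₂
  hOA : inIco h₁ h₂ (G.Orow (c - 1))
  hXA : inIco h₁ h₂ (G.Xrow (c - 1))
  hOB : ¬ inIco h₁ h₂ (G.Orow c)
  hXB : ¬ inIco h₁ h₂ (G.Xrow c)
  hO'A : G'.Orow (c - 1) = G.Orow c
  hO'B : G'.Orow c = G.Orow (c - 1)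
  hX'A : G'.Xrow (c - 1) = G.Xrow c
  hX'B : G'.Xrow c = G.Xrow (c - 1)
  hO' : ∀ k, k ≠ c - 1 → k ≠ c → G'.Orow k = G.Orow k
  hX' : ∀ k, k ≠ c - 1 → k ≠ c → G'.Xrow k = G.Xrow k

/-- Pentagon data in the 4-fold torus `T₄`: the underlying rectangle
`I₄(p)` of `𝔾₄`, the side of the curved edge (`left = true` means the curved
vertical edge is the east edge of the rectangle), and the lifted height `hh`
of the crossing point (`a` or `b`) serving as the fifth corner. -/
structure Pent (n : ℕ) where
  rect : Rect (2 * n)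
  left : Bool
  hh : ZMod (2 * n)
deriving DecidableEq

instance (n : ℕ) [NeZero n] : Fintype (Pent n) :=
  Fintype.ofEquiv (Rect (2 * n) × Bool × ZMod (2 * n))
    { toFun := fun p => ⟨p.1, p.2.1, p.2.2⟩
      invFun := fun p => ⟨p.rect, p.left, p.hh⟩
      left_inv := fun _ => rfl
      right_inv := fun _ => rfl }

/-- the distinguished vertical edge lies on a lift of the curved circle -/
def onCedge {n : ℕ} (C : CommData n) (p : Pent n) : Prop :=
  if p.left then pr p.rect.cE = C.c else pr p.rect.cW = C.c

/-- the crossing point (at height just below the row circle `h`) lies strictly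
inside the vertical extent of the rectangle -/
def heightOK {n : ℕ} (r : Rect (2 * n)) (h : ZMod (2 * n)) : Prop :=
  0 < (h - r.rS).val ∧ (h - r.rS).val ≤ (r.rN - r.rS).val

/-- a pentagon from `x₄ ∈ S₄(𝔾₄)` to `y₄' ∈ S₄(𝔾₄')` (with fifth corner at a
lift of the distinguished point `a`) -/
def IsPentA {n : ℕ} (C : CommData n) (x y' : GridState n) (p : Pent n) : Prop :=
  IsRect4From x y' p.rect ∧ pr p.hh = C.h₂ ∧ onCedge C p ∧ heightOK p.rect p.hh

/-- a pentagon from `y₄' ∈ S₄(𝔾₄')` to `x₄ ∈ S₄(𝔾₄)` (fifth corner at a lift of `b`) -/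
def IsPentB {n : ℕ} (C : CommData n) (y' x : GridState n) (p : Pent n) : Prop :=
  IsRect4From y' x p.rect ∧ pr p.hh = C.h₁ ∧ onCedge C p ∧ heightOK p.rect p.hh

/-- the rows along which the boundary of the pentagon runs along `γ` rather than `β_c` -/
def detourA {n : ℕ} [NeZero n] (p : Pent n) : Finset (ZMod (2 * n)) :=
  if p.left then Finset.univ.filter (fun j => inIco p.rect.rS p.hh j)
  else Finset.univ.filter (fun j => inIco p.hh p.rect.rN j)

def detourB {n : ℕ} [NeZero n] (p : Pent n) : Finset (ZMod (2 * n)) :=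
  if p.left then Finset.univ.filter (fun j => inIco p.hh p.rect.rN j)
  else Finset.univ.filter (fun j => inIco p.rect.rS p.hh j)

/-- marking-count correction along a curved edge: in a detour row `j`, if `γ` is
west (`π₄ j ∈ J`) the bigon sliver carries the column-`(c−1)` marking, otherwise
it carries the column-`c` marking; the sliver is gained or lost according to
whether the region lies east (`east = true`) or west of the curved circle. -/
def adj {n : ℕ} [NeZero n] (C : CommData n) (f : ZMod n → ZMod n) (east : Bool)
    (D : Finset (ZMod (2 * n))) (i : ZMod n) : ℤ :=
  ∑ j ∈ D,
    if inIco C.h₁ C.h₂ (pr j) then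
      (if i = C.c - 1 ∧ f (C.c - 1) = pr j then (if east then 1 else -1) else 0)
    else
      (if i = C.c ∧ f C.c = pr j then (if east then -1 else 1) else 0)

/-- `O_i[p₄]` for a pentagon counted by `P•` -/
def pentOA {n : ℕ} [NeZero n] (C : CommData n) (p : Pent n) (i : ZMod n) : ℤ :=
  (O4count C.G p.rect i : ℤ) + adj C C.G.Orow (!p.left) (detourA p) i

def pentXA {n : ℕ} [NeZero n] (C : CommData n) (p : Pent n) (i : ZMod n) : ℤ :=
  (X4count C.G p.rect i : ℤ) + adj C C.G.Xrow (!p.left) (detourA p) i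

def pentXDisjA {n : ℕ} [NeZero n] (C : CommData n) (p : Pent n) : Prop :=
  ∀ i, pentXA C p i = 0

def pentOB {n : ℕ} [NeZero n] (C : CommData n) (p : Pent n) (i : ZMod n) : ℤ :=
  (O4count C.G p.rect i : ℤ) + adj C C.G.Orow (!p.left) (detourB p) i

def pentXB {n : ℕ} [NeZero n] (C : CommData n) (p : Pent n) (i : ZMod n) : ℤ :=
  (X4count C.G p.rect i : ℤ) + adj C C.G.Xrow (!p.left) (detourB p) i

def pentXDisjB {n : ℕ} [NeZero n] (C : CommData n) (p : Pent n) : Prop :=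
  ∀ i, pentXB C p i = 0

/-- the weight `V₁^{O₁[p₄]}⋯V_n^{O_n[p₄]} v^{m[p₄]}`, with `m[p₄] = m[I₄(p₄)]` -/
def pentWtA {n : ℕ} [NeZero n] (C : CommData n) (x y' : GridState n) (p : Pent n) : Rng n :=
  (∏ i : ZMod n, Vv i ^ (pentOA C p i).toNat) * vV ^ m4 x y' p.rect

def pentWtB {n : ℕ} [NeZero n] (C : CommData n) (y' x : GridState n) (p : Pent n) : Rng n :=
  (∏ i : ZMod n, Vv i ^ (pentOB C p i).toNat) * vV ^ m4 y' x p.rect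

/-- the pentagon-counting map `P• : GC•(𝔾₄) → GC•(𝔾₄')` -/
def Pmap {n : ℕ} [NeZero n] (C : CommData n) : GC n →ₗ[Rng n] GC n :=
  basisMap fun x => ∑ y' : GridState n,
    ∑ p ∈ Finset.univ.filter (fun p : Pent n =>
        IsPentA C x y' p ∧ normal4 p.rect ∧ pentXDisjA C p),
      Finsupp.single y' (pentWtA C x y' p)

/-- the pentagon-counting map `(P•)' : GC•(𝔾₄') → GC•(𝔾₄)` -/
def P'map {n : ℕ} [NeZero n] (C : CommData n) : GC n →ₗ[Rng n] GC n :=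
  basisMap fun y' => ∑ x : GridState n,
    ∑ p ∈ Finset.univ.filter (fun p : Pent n =>
        IsPentB C y' x p ∧ normal4 p.rect ∧ pentXDisjB C p),
      Finsupp.single x (pentWtB C y' x p)

/-- Hexagon data: the underlying rectangle `I₄(h₄)` of `𝔾₄`, the side of its
curved edge, and the lifted heights of its two crossing-point corners
(`ha` a lift of `a`, `hb` a lift of `b`). -/
structure Hex (n : ℕ) where
  rect : Rect (2 * n)
  left : Bool
  ha : ZMod (2 * n)
  hb : ZMod (2 * n)
deriving DecidableEq

instance (n : ℕ) [NeZero n] : Fintype (Hex n) :=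
  Fintype.ofEquiv (Rect (2 * n) × Bool × ZMod (2 * n) × ZMod (2 * n))
    { toFun := fun p => ⟨p.1, p.2.1, p.2.2.1, p.2.2.2⟩
      invFun := fun p => ⟨p.rect, p.left, p.ha, p.hb⟩
      left_inv := fun _ => rfl
      right_inv := fun _ => rfl }

def onCedgeH {n : ℕ} (C : CommData n) (h : Hex n) : Prop :=
  if h.left then pr h.rect.cE = C.c else pr h.rect.cW = C.c

/-- a hexagon from `x₄` to `y₄` (both states of `𝔾₄`) -/
def IsHex {n : ℕ} (C : CommData n) (x y : GridState n) (h : Hex n) : Prop :=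
  IsRect4From x y h.rect ∧ pr h.ha = C.h₂ ∧ pr h.hb = C.h₁ ∧ onCedgeH C h ∧
  heightOK h.rect h.ha ∧ heightOK h.rect h.hb

/-- the rows between the two crossing-point corners of a hexagon -/
def detourH {n : ℕ} [NeZero n] (h : Hex n) : Finset (ZMod (2 * n)) :=
  if (h.ha - h.rect.rS).val < (h.hb - h.rect.rS).val then
    Finset.univ.filter (fun j => inIco h.ha h.hb j)
  else Finset.univ.filter (fun j => inIco h.hb h.ha j)

def hexO {n : ℕ} [NeZero n] (C : CommData n) (h : Hex n) (i : ZMod n) : ℤ :=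
  (O4count C.G h.rect i : ℤ) + adj C C.G.Orow (!h.left) (detourH h) i

def hexX {n : ℕ} [NeZero n] (C : CommData n) (h : Hex n) (i : ZMod n) : ℤ :=
  (X4count C.G h.rect i : ℤ) + adj C C.G.Xrow (!h.left) (detourH h) i

def hexXDisj {n : ℕ} [NeZero n] (C : CommData n) (h : Hex n) : Prop :=
  ∀ i, hexX C h i = 0

def hexWt {n : ℕ} [NeZero n] (C : CommData n) (x y : GridState n) (h : Hex n) : Rng n :=
  (∏ i : ZMod n, Vv i ^ (hexO C h i).toNat) * vV ^ m4 x y h.rect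

/-- the hexagon-counting map `H• : GC•(𝔾₄) → GC•(𝔾₄)` -/
def Hmap {n : ℕ} [NeZero n] (C : CommData n) : GC n →ₗ[Rng n] GC n :=
  basisMap fun x => ∑ y : GridState n,
    ∑ h ∈ Finset.univ.filter (fun h : Hex n =>
        IsHex C x y h ∧ normal4 h.rect ∧ hexXDisj C h),
      Finsupp.single y (hexWt C x y h)

/-! ### Double-point enhanced grid homology -/

def cycles {n : ℕ} [NeZero n] (G : GridDiagram n) : Submodule (Rng n) (GC n) :=
  LinearMap.ker (diffB G)

def bdrIn {n : ℕ} [NeZero n] (G : GridDiagram n) : Submodule (Rng n) ↥(cycles G) :=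
  Submodule.comap (cycles G).subtype (LinearMap.range (diffB G))

instance GHquotInst {n : ℕ} [NeZero n] (G : GridDiagram n) :
    HasQuotient ↥(cycles G) (Submodule (Rng n) ↥(cycles G)) :=
  @Submodule.hasQuotient (Rng n) ↥(cycles G) CommRing.toRing
    (Submodule.addCommGroup (cycles G)) (Submodule.module (cycles G))

/-- the double-point enhanced grid homology `GH•(𝔾)` -/
abbrev GH {n : ℕ} [NeZero n] (G : GridDiagram n) := ↥(cycles G) ⧸ bdrIn G

/-- a homology class is homogeneous of degree `(d,s)` if it has a homogeneous
cycle representative -/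
def GHhomog {n : ℕ} [NeZero n] (G : GridDiagram n) (h : GH G) (d s : ℚ) : Prop :=
  ∃ w : ↥(cycles G), (@Submodule.Quotient.mk (Rng n) ↥(cycles G) CommRing.toRing
      (Submodule.addCommGroup (cycles G)) (Submodule.module (cycles G)) (bdrIn G) w : GH G) = h ∧ IsHomog G (w : GC n) d s

/-! ### Commutation and stabilization moves as relations on grid diagrams -/

/-- `𝔾` and `𝔾'` differ by a column commutation move -/
def IsColComm {n : ℕ} (G G' : GridDiagram n) : Prop :=
  ∃ C : CommData n, C.G = G ∧ C.G' = G'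

/-- the transposed grid diagram (exchanging the roles of rows and columns) -/
def GridDiagram.transpose {n : ℕ} (G : GridDiagram n) : GridDiagram n where
  Orow := ⇑(Equiv.ofBijective G.Orow G.hO).symm
  Xrow := ⇑(Equiv.ofBijective G.Xrow G.hX).symm
  hO := (Equiv.ofBijective G.Orow G.hO).symm.bijective
  hX := (Equiv.ofBijective G.Xrow G.hX).symm.bijective
  hOX := by
    intro i h
    apply G.hOX ((Equiv.ofBijective G.Orow G.hO).symm i)
    have h1 : G.Orow ((Equiv.ofBijective G.Orow G.hO).symm i) = i :=
      Equiv.ofBijective_apply_symm_apply G.Orow G.hO i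
    have h2 : G.Xrow ((Equiv.ofBijective G.Xrow G.hX).symm i) = i :=
      Equiv.ofBijective_apply_symm_apply G.Xrow G.hX i
    rw [h1, h, h2]

/-- `𝔾` and `𝔾'` differ by a row commutation move -/
def IsRowComm {n : ℕ} (G G' : GridDiagram n) : Prop :=
  IsColComm G.transpose G'.transpose

/-- collapse map identifying `a` and `a+1` (used to destabilize) -/
def coll {n : ℕ} (a k : ZMod (n + 1)) : ZMod n :=
  (a.val : ZMod n) + (((k - a).val - 1 : ℕ) : ZMod n)

/-- `𝔾'` is obtained from `𝔾` by a stabilization with new 2×2 block at columns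
`c', c'+1` and rows `r', r'+1`; the empty square of the block sits at the corner
selected by `(ec, er)` (east column?, north row?), and `xty` records whether the
block carries two `X`-markings (type `X:·`) or two `O`-markings (type `O:·`).
E.g. `(ec, er, xty) = (false, false, true)` is type `X:SW`, with
`O₁ = (c'+1, r'+1)`, `X₁ = (c', r'+1)`, `X₂ = (c'+1, r')`. -/
def IsStabAt {n : ℕ} (G : GridDiagram n) (G' : GridDiagram (n + 1))
    (c' r' : ZMod (n + 1)) (ec er xty : Bool) : Prop :=
  (if xty then
    G'.Orow (if ec then c' else c' + 1) = (if er then r' else r' + 1) ∧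
    G'.Xrow (if ec then c' + 1 else c') = (if er then r' else r' + 1) ∧
    G'.Xrow (if ec then c' else c' + 1) = (if er then r' + 1 else r') ∧
    G.Xrow (c'.val : ZMod n) = (r'.val : ZMod n) ∧
    G.Orow (c'.val : ZMod n) = coll r' (G'.Orow (if ec then c' + 1 else c'))
  else
    G'.Xrow (if ec then c' else c' + 1) = (if er then r' else r' + 1) ∧
    G'.Orow (if ec then c' + 1 else c') = (if er then r' else r' + 1) ∧
    G'.Orow (if ec then c' else c' + 1) = (if er then r' + 1 else r') ∧
    G.Orow (c'.val : ZMod n) = (r'.val : ZMod n) ∧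
    G.Xrow (c'.val : ZMod n) = coll r' (G'.Xrow (if ec then c' + 1 else c'))) ∧
  (∀ k : ZMod (n + 1), k ≠ c' → k ≠ c' + 1 →
    G.Orow (coll c' k) = coll r' (G'.Orow k) ∧ G.Xrow (coll c' k) = coll r' (G'.Xrow k))

/-- `𝔾'` is obtained from `𝔾` by a stabilization move of one of the standard types -/
def IsStab {n : ℕ} (G : GridDiagram n) (G' : GridDiagram (n + 1)) : Prop :=
  ∃ c' r' ec er xty, IsStabAt G G' c' r' ec er xty

/-! ### The stabilization machinery (type `X:SW`) for the 4-fold complexes -/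

/-- projection of `GC•(𝔾₄')` onto the span `I₄` of states containing the
distinguished point `c = (c'+1, r'+1)` -/
def pI {n : ℕ} (c' r' : ZMod (n + 1)) : GC (n + 1) →ₗ[Rng (n + 1)] GC (n + 1) :=
  basisMap fun x => if x (c' + 1) = r' + 1 then Finsupp.single x 1 else 0

/-- projection onto the complementary span `N₄` -/
def pN {n : ℕ} (c' r' : ZMod (n + 1)) : GC (n + 1) →ₗ[Rng (n + 1)] GC (n + 1) :=
  basisMap fun x => if x (c' + 1) = r' + 1 then 0 else Finsupp.single x 1

/-- the submodule `I₄` -/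
def Isub {n : ℕ} (c' r' : ZMod (n + 1)) : Submodule (Rng (n + 1)) (GC (n + 1)) :=
  Finsupp.supported (Rng (n + 1)) (Rng (n + 1)) {x : GridState (n + 1) | x (c' + 1) = r' + 1}

/-- the submodule `N₄` -/
def Nsub {n : ℕ} (c' r' : ZMod (n + 1)) : Submodule (Rng (n + 1)) (GC (n + 1)) :=
  Finsupp.supported (Rng (n + 1)) (Rng (n + 1)) {x : GridState (n + 1) | x (c' + 1) ≠ r' + 1}

/-- the components `∂_{I₄}^{I₄}`, `∂_{I₄}^{N₄}`, `∂_{N₄}^{N₄}` of `∂₄•` -/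
def dII {n : ℕ} [NeZero (n + 1)] (G' : GridDiagram (n + 1)) (c' r' : ZMod (n + 1)) :
    GC (n + 1) →ₗ[Rng (n + 1)] GC (n + 1) :=
  pI c' r' ∘ₗ diff4 G' ∘ₗ pI c' r'

def dIN {n : ℕ} [NeZero (n + 1)] (G' : GridDiagram (n + 1)) (c' r' : ZMod (n + 1)) :
    GC (n + 1) →ₗ[Rng (n + 1)] GC (n + 1) :=
  pN c' r' ∘ₗ diff4 G' ∘ₗ pI c' r'

def dNN {n : ℕ} [NeZero (n + 1)] (G' : GridDiagram (n + 1)) (c' r' : ZMod (n + 1)) :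
    GC (n + 1) →ₗ[Rng (n + 1)] GC (n + 1) :=
  pN c' r' ∘ₗ diff4 G' ∘ₗ pN c' r'

/-- section of the column collapse map, avoiding the new column `c'+1` -/
def sect {n : ℕ} (a : ZMod (n + 1)) (k : ZMod n) : ZMod (n + 1) :=
  a + (if k - (a.val : ZMod n) = 0 then 0
       else (((k - (a.val : ZMod n)).val + 1 : ℕ) : ZMod (n + 1)))

def stCollFun {n : ℕ} (c' r' : ZMod (n + 1)) (x : GridState (n + 1)) :
    ZMod n → ZMod n :=
  fun k => coll r' (x (sect c' k))

/-- the destabilized grid state `x` corresponding to `x' = x ∪ {c}` -/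
def stColl {n : ℕ} (c' r' : ZMod (n + 1)) (x : GridState (n + 1)) : GridState n :=
  if h : Function.Bijective (stCollFun c' r' x) then Equiv.ofBijective _ h else 1

/-- the promoted module `GC•(𝔾₄)[V₁]`: the free `𝔽[V₁,…,V_n,v]`-module on the
grid states of the destabilized diagram -/
abbrev GCP (n : ℕ) := GridState n →₀ Rng (n + 1)

def basisMapP {n : ℕ} (f : GridState n → GCP n) : GCP n →ₗ[Rng (n + 1)] GCP n :=
  Finsupp.lsum (Rng (n + 1)) fun x => LinearMap.toSpanSingleton (Rng (n + 1)) (GCP n) (f x)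

/-- the identification `e₄` (extended by zero on `N₄`) -/
def e4map {n : ℕ} (c' r' : ZMod (n + 1)) : GC (n + 1) →ₗ[Rng (n + 1)] GCP n :=
  Finsupp.lsum (Rng (n + 1)) fun x =>
    LinearMap.toSpanSingleton (Rng (n + 1)) (GCP n)
      (if x (c' + 1) = r' + 1 then Finsupp.single (stColl c' r' x) (1 : Rng (n + 1)) else 0)

/-- renaming of the variables of the destabilized diagram into those of `𝔾'` -/
def renUp {n : ℕ} (c' : ZMod (n + 1)) : Rng n →+* Rng (n + 1) :=
  (MvPolynomial.rename (Option.map (sect c')) :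
      MvPolynomial (Option (ZMod n)) F →ₐ[F] MvPolynomial (Option (ZMod (n + 1))) F).toRingHom

/-- the differential of the promoted complex `GC•(𝔾₄)[V₁]` -/
def diffP {n : ℕ} [NeZero n] (G : GridDiagram n) (c' : ZMod (n + 1)) :
    GCP n →ₗ[Rng (n + 1)] GCP n :=
  basisMapP fun x => ∑ y : GridState n,
    ∑ r ∈ Finset.univ.filter
        (fun r : Rect (2 * n) => IsRect4From x y r ∧ normal4 r ∧ XDisjoint4 G r),
      Finsupp.single y (renUp c' (wt4 G x y r))

/-- homogeneity on the promoted complex -/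
def IsHomogP {n : ℕ} [NeZero n] (G : GridDiagram n) (z : GCP n) (d s : ℚ) : Prop :=
  ∀ (y : GridState n) (k : Option (ZMod (n + 1)) →₀ ℕ), MvPolynomial.coeff k (z y) ≠ 0 →
    (MaslovO G y - 2 * ∑ i : ZMod (n + 1), (k (some i) : ℚ) + 2 * (k none : ℚ) = d) ∧
    (Alex G y - ∑ i : ZMod (n + 1), (k (some i) : ℚ) = s)

/-- the map counting equivalence classes of rectangles crossing `X₂` (the
`X`-marking of column `c'+1`) once and no other `X`-marking -/
def HX2map {n : ℕ} (G' : GridDiagram (n + 1)) (c' : ZMod (n + 1)) :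
    GC (n + 1) →ₗ[Rng (n + 1)] GC (n + 1) :=
  basisMap fun x => ∑ y : GridState (n + 1),
    ∑ r ∈ Finset.univ.filter (fun r : Rect (2 * (n + 1)) =>
        IsRect4From x y r ∧ normal4 r ∧ X4count G' r (c' + 1) = 1 ∧
        ∀ k, k ≠ c' + 1 → X4count G' r k = 0),
      Finsupp.single y (wt4 G' x y r)

/-- its component `𝓗_{X₂}^{I₄} : N₄ → I₄` -/
def hX2I {n : ℕ} (G' : GridDiagram (n + 1)) (c' r' : ZMod (n + 1)) :
    GC (n + 1) →ₗ[Rng (n + 1)] GC (n + 1) :=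
  pI c' r' ∘ₗ HX2map G' c' ∘ₗ pN c' r'

/-- weight with the variable `V_j` evaluated at `1` -/
def wtNo {n : ℕ} [NeZero n] (G : GridDiagram n) (x y : GridState n) (j : ZMod n)
    (r : Rect (2 * n)) : Rng n :=
  (∏ i ∈ Finset.univ.erase j, Vv i ^ O4count G r i) * vV ^ m4 x y r

/-- `𝓗_{O₁}•`: counts `X`-disjoint rectangles crossing `O₁` (the `O`-marking of
column `c'+1`) once, with `V₁` evaluated at `1` -/
def HO1map {n : ℕ} (G' : GridDiagram (n + 1)) (c' : ZMod (n + 1)) :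
    GC (n + 1) →ₗ[Rng (n + 1)] GC (n + 1) :=
  basisMap fun x => ∑ y : GridState (n + 1),
    ∑ r ∈ Finset.univ.filter (fun r : Rect (2 * (n + 1)) =>
        IsRect4From x y r ∧ normal4 r ∧ XDisjoint4 G' r ∧ O4count G' r (c' + 1) = 1),
      Finsupp.single y (wtNo G' x y (c' + 1) r)

/-- its component `I₄ → N₄` -/
def hO1N {n : ℕ} (G' : GridDiagram (n + 1)) (c' r' : ZMod (n + 1)) :
    GC (n + 1) →ₗ[Rng (n + 1)] GC (n + 1) :=
  pN c' r' ∘ₗ HO1map G' c' ∘ₗ pI c' r'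

/-! ### Grid diagrams of arbitrary size, and the moves of Cromwell's theorem -/

/-- a grid diagram of unspecified (positive) grid number -/
structure GDS where
  sz : ℕ+
  D : GridDiagram (sz : ℕ)

instance (p : ℕ+) : NeZero (p : ℕ) := ⟨p.ne_zero⟩

/-- a single commutation or stabilization move -/
def MoveRel (A B : GDS) : Prop :=
  (∃ h : (A.sz : ℕ) = (B.sz : ℕ),
      IsColComm (h ▸ A.D) B.D ∨ IsRowComm (h ▸ A.D) B.D) ∨
  (∃ h : (B.sz : ℕ) = (A.sz : ℕ) + 1, IsStab A.D (h ▸ B.D))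

/-- connected by a finite sequence of commutation moves and
stabilization/destabilization moves -/
def ConnectedByMoves (A B : GDS) : Prop :=
  Relation.ReflTransGen (fun X Y => MoveRel X Y ∨ MoveRel Y X) A B

/-! ## cyclic interval indicator functions -/

lemma val_sub_eq {m : ℕ} [NeZero m] (a b : ZMod m) :
    (a - b).val = if b.val ≤ a.val then a.val - b.val else m + a.val - b.val := by
  split_ifs with h
  · exact ZMod.val_sub h
  · have hb := ZMod.val_lt b
    have h1 : a - b = ((m + a.val - b.val : ℕ) : ZMod m) := by
      rw [Nat.cast_sub (by omega)]
      simp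
    rw [h1, ZMod.val_natCast, Nat.mod_eq_of_lt (by omega)]

lemma val_sub_one {m : ℕ} [NeZero m] (hm : 1 < m) (a : ZMod m) :
    (a - 1).val = if a.val = 0 then m - 1 else a.val - 1 := by
  have : Fact (1 < m) := ⟨hm⟩
  have h := val_sub_eq a 1
  rw [ZMod.val_one] at h
  rw [h]
  split_ifs <;> omega

lemma inIco_iff {m : ℕ} (u v k : ZMod m) : inIco u v k ↔ (k - u).val < (v - u).val := Iff.rfl

lemma inIoo_iff {m : ℕ} (u v k : ZMod m) :
    inIoo u v k ↔ 0 < (k - u).val ∧ (k - u).val < (v - u).val := Iff.rfl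

/-- indicator of `[u, v)` -/
def chi {m : ℕ} (u v k : ZMod m) : ℚ := if inIco u v k then 1 else 0

/-- indicator of `(u, v)` -/
def cho {m : ℕ} (u v k : ZMod m) : ℚ := if inIoo u v k then 1 else 0

lemma chi_val {m : ℕ} [NeZero m] (i j k : ZMod m) :
    chi i j k = (if i.val ≤ k.val then 1 else 0) - (if j.val ≤ k.val then 1 else 0)
      + (if j.val < i.val then 1 else 0) := by
  have h1 := ZMod.val_lt i
  have h2 := ZMod.val_lt j
  have h3 := ZMod.val_lt k
  simp only [chi, inIco_iff]
  rw [val_sub_eq, val_sub_eq]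
  split_ifs <;> first | omega | norm_num

lemma chi_sub_one_val {m : ℕ} [NeZero m] (hm : 1 < m) (i j k : ZMod m) :
    chi i j (k - 1) = (if i.val < k.val then 1 else 0) - (if j.val < k.val then 1 else 0)
      + (if j.val < i.val then 1 else 0) := by
  have h1 := ZMod.val_lt i
  have h2 := ZMod.val_lt j
  have h3 := ZMod.val_lt k
  rw [chi_val, val_sub_one hm]
  split_ifs <;> first | omega | norm_num

lemma chi_eq_cho {m : ℕ} [NeZero m] (i j k : ZMod m) (h : i ≠ j) :
    chi i j k = cho i j k + if k = i then 1 else 0 := by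
  have h1 := ZMod.val_lt i
  have h2 := ZMod.val_lt j
  have h3 := ZMod.val_lt k
  have h4 : i.val ≠ j.val := fun e => h (ZMod.val_injective _ e)
  have h5 : k = i ↔ k.val = i.val := (ZMod.val_injective _).eq_iff.symm
  simp only [chi, cho, inIco_iff, inIoo_iff]
  rw [val_sub_eq, val_sub_eq]
  simp only [h5]
  split_ifs <;> first | omega | norm_num

lemma chi_sub_one_eq_cho {m : ℕ} [NeZero m] (hm : 1 < m) (i j k : ZMod m) (h : i ≠ j) :
    chi i j (k - 1) = cho i j k + if k = j then 1 else 0 := by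
  have h1 := ZMod.val_lt i
  have h2 := ZMod.val_lt j
  have h3 := ZMod.val_lt k
  have h4 : i.val ≠ j.val := fun e => h (ZMod.val_injective _ e)
  have h5 : k = j ↔ k.val = j.val := (ZMod.val_injective _).eq_iff.symm
  rw [chi_sub_one_val hm]
  simp only [cho, inIoo_iff]
  rw [val_sub_eq, val_sub_eq]
  simp only [h5]
  split_ifs <;> first | omega | norm_num

lemma cho_left {m : ℕ} (i j : ZMod m) : cho i j i = 0 := by
  simp [cho, inIoo]

lemma cho_right {m : ℕ} (i j : ZMod m) : cho i j j = 0 := by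
  simp [cho, inIoo]

lemma mult_eq {m : ℕ} (r : Rect m) (a b : ZMod m) :
    ((r.mult (a, b) : ℕ) : ℚ) = chi r.cW r.cE a * chi r.rS r.rN b := by
  unfold Rect.mult chi
  split_ifs <;> simp_all

lemma chi_nonneg {m : ℕ} (u v k : ZMod m) : 0 ≤ chi u v k := by
  unfold chi; split_ifs <;> norm_num

lemma chi_start {m : ℕ} [NeZero m] (u v : ZMod m) (h : u ≠ v) : chi u v u = 1 := by
  rw [chi_eq_cho _ _ _ h, cho_left]; simp

/-- defect of additivity of cyclic intervals -/
def kap {m : ℕ} (a b c : ZMod m) : ℚ :=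
  (if b.val < a.val then 1 else 0) + (if c.val < b.val then 1 else 0)
    - (if c.val < a.val then 1 else 0)

lemma chi_add {m : ℕ} [NeZero m] (a b c k : ZMod m) :
    chi a b k + chi b c k = chi a c k + kap a b c := by
  simp only [chi_val, kap]; ring

lemma kap_or {m : ℕ} [NeZero m] (a b c : ZMod m) (h : b ≠ c) :
    (kap a b c = 0 ∧ kap a c b = 1) ∨ (kap a b c = 1 ∧ kap a c b = 0) := by
  have h4 : b.val ≠ c.val := fun e => h (ZMod.val_injective _ e)
  unfold kap
  split_ifs <;> first | omega | norm_num

lemma kap_rot {m : ℕ} [NeZero m] (a b c : ZMod m) (h : b ≠ c) (h' : a ≠ c) :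
    kap a b c = kap c a b := by
  have h4 : b.val ≠ c.val := fun e => h (ZMod.val_injective _ e)
  have h5 : a.val ≠ c.val := fun e => h' (ZMod.val_injective _ e)
  unfold kap
  split_ifs <;> first | omega | norm_num

/-! ## rectangles at a state -/

/-- the rectangle determined by a state and its west and east columns -/
def rc {n : ℕ} (x : GridState n) (i j : ZMod n) : Rect n := ⟨i, j, x i, x j⟩

lemma intCount_eq {n : ℕ} [NeZero n] (x : GridState n) (i j : ZMod n) :
    ((Rect.intCount x (rc x i j) : ℕ) : ℚ) = ∑ k, cho i j k * cho (x i) (x j) (x k) := by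
  unfold Rect.intCount
  rw [Finset.card_filter]
  push_cast
  refine Finset.sum_congr rfl fun k _ => ?_
  by_cases h1 : inIoo i j k <;> by_cases h2 : inIoo (x i) (x j) (x k) <;>
    simp [rc, cho, h1, h2]

lemma sumA {n : ℕ} [NeZero n] (hn : 1 < n) (x : GridState n) (i j : ZMod n) (h : i ≠ j) :
    ∑ k, chi i j (k - 1) * chi (x i) (x j) (x k - 1)
      = (Rect.intCount x (rc x i j) : ℚ) + 1 := by
  rw [intCount_eq]
  have hx : x i ≠ x j := fun e => h (x.injective e)
  have : (1 : ℚ) = ∑ k : ZMod n, if k = j then 1 else 0 := by simp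
  rw [this, ← Finset.sum_add_distrib]
  refine Finset.sum_congr rfl fun k _ => ?_
  rw [chi_sub_one_eq_cho hn _ _ _ h, chi_sub_one_eq_cho hn _ _ _ hx]
  simp only [x.injective.eq_iff]
  split_ifs with hk
  · subst hk; simp [cho_right]
  · ring

lemma sumB {n : ℕ} [NeZero n] (x : GridState n) (i j : ZMod n) (h : i ≠ j) :
    ∑ k, chi i j k * chi (x i) (x j) ((x * Equiv.swap i j) k)
      = (Rect.intCount x (rc x i j) : ℚ) := by
  rw [intCount_eq]
  have hx : x i ≠ x j := fun e => h (x.injective e)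
  refine Finset.sum_congr rfl fun k _ => ?_
  rw [chi_eq_cho _ _ _ h, chi_eq_cho _ _ _ hx]
  simp only [Equiv.Perm.mul_apply, x.injective.eq_iff]
  by_cases hi : k = i
  · subst hi; simp [cho_left, cho_right, h.symm]
  · by_cases hj : k = j
    · subst hj; simp [cho_left, cho_right, h.symm]
    · rw [Equiv.swap_apply_of_ne_of_ne hi hj]; simp [hi]

/-- four times the point measure at a state through the four corners -/
lemma sumP {n : ℕ} [NeZero n] (hn : 1 < n) (x : GridState n) (i j s t : ZMod n) (h : i ≠ j)
    (hst : s ≠ t) (hc : (x i = s ∧ x j = t) ∨ (x i = t ∧ x j = s)) :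
    ∑ k, (chi i j (k - 1) + chi i j k) * (chi s t (x k - 1) + chi s t (x k))
      = 4 * ∑ k, cho i j k * cho s t (x k) + 2 := by
  have : (2 : ℚ) = ∑ k : ZMod n, ((if k = j then 1 else 0) + (if k = i then 1 else 0)) := by
    rw [Finset.sum_add_distrib]; simp; norm_num
  rw [this, Finset.mul_sum, ← Finset.sum_add_distrib]
  refine Finset.sum_congr rfl fun k _ => ?_
  rw [chi_sub_one_eq_cho hn _ _ _ h, chi_sub_one_eq_cho hn _ _ _ hst, chi_eq_cho _ _ _ h,
    chi_eq_cho _ _ _ hst]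
  rcases hc with ⟨h1, h2⟩ | ⟨h1, h2⟩ <;> subst h1 h2 <;>
  · simp only [x.injective.eq_iff]
    by_cases hi : k = i
    · subst hi; simp [cho_left, cho_right, h]
    · by_cases hj : k = j
      · subst hj; simp [cho_left, cho_right, h.symm]
      · simp [hi, hj]; ring

lemma sum_cho_swap {n : ℕ} [NeZero n] (x : GridState n) (i j s t : ZMod n) :
    ∑ k, cho i j k * cho s t ((x * Equiv.swap i j) k) = ∑ k, cho i j k * cho s t (x k) := by
  refine Finset.sum_congr rfl fun k _ => ?_
  simp only [Equiv.Perm.mul_apply]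
  by_cases hi : k = i
  · subst hi; simp [cho_left]
  · by_cases hj : k = j
    · subst hj; simp [cho_right]
    · rw [Equiv.swap_apply_of_ne_of_ne hi hj]

/-! ## the Maslov grading change along a rectangle -/

lemma Icnt_ptsOf {m : ℕ} [NeZero m] (f g : ZMod m → ZMod m) (a b : ℕ) :
    (Icnt (ptsOf f a) (ptsOf g b) : ℚ)
      = ∑ k : ZMod m, ∑ l : ZMod m, (if 2 * k.val + a < 2 * l.val + b then (1 : ℚ) else 0) *
          (if 2 * (f k).val + a < 2 * (g l).val + b then 1 else 0) := by
  have hinj : ∀ (f : ZMod m → ZMod m) (a : ℕ), Function.Injective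
      (fun k : ZMod m => (2 * k.val + a, 2 * (f k).val + a)) := by
    intro f a k l h
    apply ZMod.val_injective
    have := congrArg Prod.fst h
    simp only at this
    omega
  unfold Icnt
  conv_lhs => rw [ptsOf]
  rw [Finset.sum_image (fun _ _ _ _ h => hinj f a h)]
  push_cast
  refine Finset.sum_congr rfl fun k _ => ?_
  rw [Finset.card_filter, ptsOf, Finset.sum_image (fun _ _ _ _ h => hinj g b h)]
  push_cast
  refine Finset.sum_congr rfl fun l _ => ?_
  rw [ite_and]
  split_ifs <;> norm_num

lemma sum_swap_diff {m : ℕ} [NeZero m] (x : GridState m) (i j : ZMod m) (h : i ≠ j)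
    (H : ZMod m → ZMod m → ℚ) :
    ∑ k, H k (x k) - ∑ k, H k ((x * Equiv.swap i j) k)
      = H i (x i) + H j (x j) - H i (x j) - H j (x i) := by
  rw [← Finset.sum_sub_distrib]
  rw [← Finset.sum_subset (Finset.subset_univ {i, j})]
  · rw [Finset.sum_pair h]
    simp only [Equiv.Perm.mul_apply, Equiv.swap_apply_left, Equiv.swap_apply_right]
    ring
  · intro k _ hk
    simp only [Finset.mem_insert, Finset.mem_singleton, not_or] at hk
    simp only [Equiv.Perm.mul_apply]
    rw [Equiv.swap_apply_of_ne_of_ne hk.1 hk.2, sub_self]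

lemma lt0 (a b : ℕ) : (2 * a + 0 < 2 * b + 0) ↔ a < b := by omega
lemma lt1 (a b : ℕ) : (2 * a + 0 < 2 * b + 1) ↔ a ≤ b := by omega
lemma lt2 (a b : ℕ) : (2 * a + 1 < 2 * b + 0) ↔ a < b := by omega

lemma ite_lt_flip (a b : ℕ) :
    (if a < b then (1 : ℚ) else 0) = 1 - (if b ≤ a then 1 else 0) := by
  split_ifs <;> first | omega | norm_num

/-- `1` if the interval wraps around -/
def wr {m : ℕ} (i j : ZMod m) : ℚ := if j.val < i.val then 1 else 0

lemma dL {m : ℕ} [NeZero m] (hm : 1 < m) (i j l : ZMod m) :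
    (if i.val < l.val then (1 : ℚ) else 0) - (if j.val < l.val then 1 else 0)
      = chi i j (l - 1) - wr i j := by
  rw [chi_sub_one_val hm, wr]; ring

lemma dLe {m : ℕ} [NeZero m] (i j l : ZMod m) :
    (if i.val ≤ l.val then (1 : ℚ) else 0) - (if j.val ≤ l.val then 1 else 0)
      = chi i j l - wr i j := by
  rw [chi_val, wr]; ring

lemma dR {m : ℕ} [NeZero m] (i j l : ZMod m) :
    (if l.val < i.val then (1 : ℚ) else 0) - (if l.val < j.val then 1 else 0)
      = - (chi i j l - wr i j) := by
  rw [← dLe, ite_lt_flip, ite_lt_flip]; ring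

lemma sum_shift {m : ℕ} [NeZero m] (i j s t : ZMod m) (a b : ℚ) (σ τ : ZMod m → ZMod m)
    (hσ : σ.Bijective) (hτ : τ.Bijective) :
    ∑ k, (chi i j (σ k) - a) * (chi s t (τ k) - b)
      = ∑ k, chi i j (σ k) * chi s t (τ k) - b * ∑ k, chi i j k - a * ∑ k, chi s t k
        + m * a * b := by
  rw [← hσ.sum_comp (chi i j), ← hτ.sum_comp (chi s t)]
  rw [Finset.mul_sum, Finset.mul_sum, ← Finset.sum_sub_distrib, ← Finset.sum_sub_distrib]
  have : (m : ℚ) * a * b = ∑ k : ZMod m, a * b := by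
    simp [ZMod.card]; ring
  rw [this, ← Finset.sum_add_distrib]
  refine Finset.sum_congr rfl fun k _ => ?_
  ring

lemma maslov_diff {n : ℕ} [NeZero n] (hn : 1 < n) (f : ZMod n → ZMod n) (hf : f.Bijective)
    (x : GridState n) (i j : ZMod n) (h : i ≠ j) :
    MaslovOf f x - MaslovOf f (x * Equiv.swap i j)
      = 1 + 2 * (Rect.intCount x (rc x i j) : ℚ) - 2 * ∑ k, ((rc x i j).mult (k, f k) : ℚ) := by
  set y : GridState n := x * Equiv.swap i j with hy
  have hx : x i ≠ x j := fun e => h (x.injective e)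
  have h1 : (Icnt (ptsOf x 0) (ptsOf x 0) : ℚ) - Icnt (ptsOf y 0) (ptsOf x 0)
      = ∑ l, (chi i j (l - 1) - wr i j) * (chi (x i) (x j) (x l - 1) - wr (x i) (x j)) := by
    simp only [Icnt_ptsOf, lt0]
    have := sum_swap_diff x i j h (fun k s => ∑ l : ZMod n, (if k.val < l.val then (1 : ℚ) else 0) *
          (if s.val < (x l).val then 1 else 0))
    simp only [← hy] at this
    rw [this, ← Finset.sum_add_distrib, ← Finset.sum_sub_distrib, ← Finset.sum_sub_distrib]
    refine Finset.sum_congr rfl fun l _ => ?_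
    rw [← dL hn, ← dL hn]; ring
  have h2 : (Icnt (ptsOf y 0) (ptsOf x 0) : ℚ) - Icnt (ptsOf y 0) (ptsOf y 0)
      = ∑ l, (chi i j l - wr i j) * (chi (x i) (x j) (y l) - wr (x i) (x j)) := by
    simp only [Icnt_ptsOf, lt0]
    rw [Finset.sum_comm, sub_eq_iff_eq_add]
    conv_rhs => rw [add_comm, Finset.sum_comm]
    rw [← sub_eq_iff_eq_add']
    have := sum_swap_diff x i j h (fun k s => ∑ l : ZMod n, (if l.val < k.val then (1 : ℚ) else 0) *
          (if (y l).val < s.val then 1 else 0))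
    simp only [← hy] at this
    rw [this, ← Finset.sum_add_distrib, ← Finset.sum_sub_distrib, ← Finset.sum_sub_distrib]
    refine Finset.sum_congr rfl fun l _ => ?_
    have e1 := dR i j l
    have e2 := dR (x i) (x j) (y l)
    conv_rhs => rw [← neg_mul_neg, ← e1, ← e2]
    ring
  have h3 : (Icnt (ptsOf x 0) (ptsOf f 1) : ℚ) - Icnt (ptsOf y 0) (ptsOf f 1)
      = ∑ l, (chi i j l - wr i j) * (chi (x i) (x j) (f l) - wr (x i) (x j)) := by
    simp only [Icnt_ptsOf, lt1]
    have := sum_swap_diff x i j h (fun k s => ∑ l : ZMod n, (if k.val ≤ l.val then (1 : ℚ) else 0) *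
          (if s.val ≤ (f l).val then 1 else 0))
    simp only [← hy] at this
    rw [this, ← Finset.sum_add_distrib, ← Finset.sum_sub_distrib, ← Finset.sum_sub_distrib]
    refine Finset.sum_congr rfl fun l _ => ?_
    rw [← dLe, ← dLe]; ring
  have h4 : (Icnt (ptsOf f 1) (ptsOf x 0) : ℚ) - Icnt (ptsOf f 1) (ptsOf y 0)
      = ∑ l, (chi i j l - wr i j) * (chi (x i) (x j) (f l) - wr (x i) (x j)) := by
    simp only [Icnt_ptsOf, lt2]
    rw [Finset.sum_comm, sub_eq_iff_eq_add]
    conv_rhs => rw [add_comm, Finset.sum_comm]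
    rw [← sub_eq_iff_eq_add']
    have := sum_swap_diff x i j h (fun k s => ∑ l : ZMod n, (if l.val < k.val then (1 : ℚ) else 0) *
          (if (f l).val < s.val then 1 else 0))
    simp only [← hy] at this
    rw [this, ← Finset.sum_add_distrib, ← Finset.sum_sub_distrib, ← Finset.sum_sub_distrib]
    refine Finset.sum_congr rfl fun l _ => ?_
    have e1 := dR i j l
    have e2 := dR (x i) (x j) (f l)
    conv_rhs => rw [← neg_mul_neg, ← e1, ← e2]
    ring
  have hs : Function.Bijective (fun k : ZMod n => k - 1) := (Equiv.subRight (1 : ZMod n)).bijective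
  have hsx : Function.Bijective (fun k : ZMod n => x k - 1) := hs.comp x.bijective
  rw [sum_shift i j (x i) (x j) _ _ (fun k : ZMod n => k - 1) (fun k => x k - 1) hs hsx,
    sumA hn x i j h] at h1
  rw [sum_shift i j (x i) (x j) _ _ (fun k => k) y Function.bijective_id y.bijective,
    sumB x i j h] at h2
  rw [sum_shift i j (x i) (x j) _ _ (fun k => k) f Function.bijective_id hf] at h3 h4
  have h5 : ∑ k, ((rc x i j).mult (k, f k) : ℚ) = ∑ k, chi i j k * chi (x i) (x j) (f k) :=
    Finset.sum_congr rfl fun k _ => mult_eq _ _ _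
  rw [h5]
  unfold MaslovOf Jq
  linear_combination h1 + h2 - h3 - h4

/-! ## pushing forward along the 4-fold cover -/

lemma one_lt_of_grid {n : ℕ} [NeZero n] (G : GridDiagram n) : 1 < n := by
  have h0 := NeZero.ne n
  rcases Nat.lt_or_ge 1 n with h | h
  · exact h
  · have : n = 1 := by omega
    subst this
    exact absurd (Subsingleton.elim _ _) (G.hOX 0)

lemma pr_val {n : ℕ} [NeZero n] (a : ZMod (2 * n)) :
    (pr a).val = if a.val < n then a.val else a.val - n := by
  have h := ZMod.val_lt a
  have h1 : pr a = ((a.val : ℕ) : ZMod n) := by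
    conv_lhs => rw [← ZMod.natCast_zmod_val a]
    simp only [pr, map_natCast]
  rw [h1, ZMod.val_natCast]
  split_ifs with h2
  · exact Nat.mod_eq_of_lt h2
  · rw [Nat.mod_eq_sub_mod (by omega), Nat.mod_eq_of_lt (by omega)]

/-- first lift -/
def lf {n : ℕ} (k : ZMod n) : ZMod (2 * n) := (k.val : ZMod (2 * n))

/-- second lift -/
def lf' {n : ℕ} (k : ZMod n) : ZMod (2 * n) := ((k.val + n : ℕ) : ZMod (2 * n))

lemma lf_val {n : ℕ} [NeZero n] (k : ZMod n) : (lf k).val = k.val := by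
  have h := ZMod.val_lt k
  rw [lf, ZMod.val_natCast, Nat.mod_eq_of_lt (by omega)]

lemma lf'_val {n : ℕ} [NeZero n] (k : ZMod n) : (lf' k).val = k.val + n := by
  have h := ZMod.val_lt k
  rw [lf', ZMod.val_natCast, Nat.mod_eq_of_lt (by omega)]

lemma zeq {m : ℕ} [NeZero m] (a b : ZMod m) : a = b ↔ a.val = b.val :=
  (ZMod.val_injective _).eq_iff.symm

lemma pr_lf {n : ℕ} [NeZero n] (k : ZMod n) : pr (lf k) = k := by
  have h := ZMod.val_lt k
  rw [zeq, pr_val, lf_val, if_pos h]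

lemma pr_eq_iff {n : ℕ} [NeZero n] (a : ZMod (2 * n)) (k : ZMod n) :
    pr a = k ↔ a = lf k ∨ a = lf' k := by
  have h := ZMod.val_lt k
  have h' := ZMod.val_lt a
  rw [zeq, zeq, zeq, pr_val, lf_val, lf'_val]
  split_ifs <;> omega

lemma pr_sub_one {n : ℕ} (a : ZMod (2 * n)) : pr (a - 1) = pr a - 1 := by
  simp [pr]

/-- fibrewise sum -/
def push {n : ℕ} [NeZero n] (g : ZMod (2 * n) → ℚ) (k : ZMod n) : ℚ :=
  ∑ a, if pr a = k then g a else 0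

lemma push_eq {n : ℕ} [NeZero n] (g : ZMod (2 * n) → ℚ) (k : ZMod n) :
    push g k = g (lf k) + g (lf' k) := by
  have hne : lf k ≠ lf' k := by
    rw [Ne, zeq, lf_val, lf'_val]
    have := NeZero.ne n
    omega
  unfold push
  rw [← Finset.sum_filter]
  have : (Finset.univ.filter fun a : ZMod (2 * n) => pr a = k) = {lf k, lf' k} := by
    ext a; simp [pr_eq_iff]
  rw [this, Finset.sum_pair hne]

lemma push_add {n : ℕ} [NeZero n] (g h : ZMod (2 * n) → ℚ) (k : ZMod n) :
    push (fun a => g a + h a) k = push g k + push h k := by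
  simp only [push_eq]; ring

lemma push_shift {n : ℕ} [NeZero n] (g : ZMod (2 * n) → ℚ) (k : ZMod n) :
    push (fun a => g (a - 1)) k = push g (k - 1) := by
  unfold push
  rw [← (Equiv.subRight (1 : ZMod (2 * n))).sum_comp (fun a => if pr a = k - 1 then g a else 0)]
  refine Finset.sum_congr rfl fun a _ => ?_
  simp [pr_sub_one]

lemma push_chi {n : ℕ} [NeZero n] (u v : ZMod (2 * n)) (h : (v - u).val < n) (k : ZMod n) :
    push (chi u v) k = chi (pr u) (pr v) k := by
  have h1 := ZMod.val_lt k
  have h2 := ZMod.val_lt u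
  have h3 := ZMod.val_lt v
  have key : (inIco (pr u) (pr v) k ↔ inIco u v (lf k) ∨ inIco u v (lf' k)) ∧
      ¬ (inIco u v (lf k) ∧ inIco u v (lf' k)) := by
    rw [val_sub_eq] at h
    simp only [inIco_iff, val_sub_eq, pr_val, lf_val, lf'_val]
    generalize k.val = K at *
    generalize u.val = U at *
    generalize v.val = V at *
    by_cases c1 : U < n <;> by_cases c2 : V < n <;> by_cases c3 : U ≤ V <;>
      simp only [c1, c2, c3, if_true, if_false] at h ⊢ <;> constructor <;> split_ifs <;> omega
  rw [push_eq]
  unfold chi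
  rcases key with ⟨k1, k2⟩
  by_cases p : inIco u v (lf k) <;> by_cases q : inIco u v (lf' k) <;>
    simp_all

lemma push_prod {n : ℕ} [NeZero n] (g h : ZMod (2 * n) → ℚ) (k l : ZMod n) :
    ∑ p : ZMod (2 * n) × ZMod (2 * n), (if pr p.1 = k ∧ pr p.2 = l then g p.1 * h p.2 else 0)
      = push g k * push h l := by
  rw [Fintype.sum_prod_type]
  unfold push
  rw [Finset.sum_mul_sum]
  refine Finset.sum_congr rfl fun a _ => Finset.sum_congr rfl fun b _ => ?_
  by_cases h1 : pr a = k <;> by_cases h2 : pr b = l <;> simp [h1, h2]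

lemma push_state {n : ℕ} [NeZero n] (g h : ZMod (2 * n) → ℚ) (w : GridState n) :
    ∑ p : ZMod (2 * n) × ZMod (2 * n), (if w (pr p.1) = pr p.2 then g p.1 * h p.2 else 0)
      = ∑ k, push g k * push h (w k) := by
  simp only [← push_prod]
  rw [Finset.sum_comm]
  refine Finset.sum_congr rfl fun p _ => ?_
  rw [Finset.sum_eq_single (pr p.1)]
  · simp [eq_comm]
  · intro b _ hb
    simp [hb.symm]
  · simp

/-- projection of a rectangle -/
def prR {n : ℕ} (r : Rect (2 * n)) : Rect n := ⟨pr r.cW, pr r.cE, pr r.rS, pr r.rN⟩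

/-- a rectangle of width and height less than `n` -/
def small {n : ℕ} (r : Rect (2 * n)) : Prop :=
  (r.cE - r.cW).val < n ∧ (r.rN - r.rS).val < n

lemma fib_mult {n : ℕ} [NeZero n] (r : Rect (2 * n)) (hs : small r) (k l : ZMod n) :
    (∑ p : ZMod (2 * n) × ZMod (2 * n), if pr p.1 = k ∧ pr p.2 = l then r.mult p else 0)
      = (prR r).mult (k, l) := by
  rw [← Nat.cast_inj (R := ℚ), mult_eq]
  push_cast
  have h1 := push_prod (chi r.cW r.cE) (chi r.rS r.rN) k l
  rw [push_chi _ _ hs.1, push_chi _ _ hs.2] at h1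
  simp only [prR]
  rw [← h1]
  refine Finset.sum_congr rfl fun p _ => ?_
  rw [← mult_eq]

lemma O4_eq {n : ℕ} [NeZero n] (G : GridDiagram n) (r : Rect (2 * n)) (hs : small r)
    (i : ZMod n) : O4count G r i = Ocount G (prR r) i := fib_mult r hs _ _

lemma X4_eq {n : ℕ} [NeZero n] (G : GridDiagram n) (r : Rect (2 * n)) (hs : small r)
    (i : ZMod n) : X4count G r i = Xcount G (prR r) i := fib_mult r hs _ _

lemma rpm4_eq {n : ℕ} [NeZero n] (w : GridState n) (r : Rect (2 * n)) (hs : small r) :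
    rpm4 w r = (∑ k, (chi (pr r.cW) (pr r.cE) (k - 1) + chi (pr r.cW) (pr r.cE) k) *
      (chi (pr r.rS) (pr r.rN) (w k - 1) + chi (pr r.rS) (pr r.rN) (w k))) / 4 := by
  have h := push_state (fun a => chi r.cW r.cE (a - 1) + chi r.cW r.cE a)
    (fun a => chi r.rS r.rN (a - 1) + chi r.rS r.rN a) w
  simp only [push_add, push_shift, push_chi _ _ hs.1, push_chi _ _ hs.2] at h
  rw [← h]
  unfold rpm4 pm4 Rect.dom4
  congr 1
  refine Finset.sum_congr rfl fun p _ => ?_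
  congr 1
  push_cast
  rw [mult_eq, mult_eq, mult_eq, ← Prod.mk.eta (p := p), mult_eq]
  ring

lemma m4_eq {n : ℕ} [NeZero n] (hn : 1 < n) (x : GridState n) (r : Rect (2 * n))
    (hs : small r) (i j : ZMod n) (hij : i ≠ j) (hr : prR r = rc x i j) :
    m4 x (x * Equiv.swap i j) r = Rect.intCount x (rc x i j) := by
  have hx : x i ≠ x j := fun e => hij (x.injective e)
  have e1 : pr r.cW = i := congrArg Rect.cW hr
  have e2 : pr r.cE = j := congrArg Rect.cE hr
  have e3 : pr r.rS = x i := congrArg Rect.rS hr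
  have e4 : pr r.rN = x j := congrArg Rect.rN hr
  have : mQ4 x (x * Equiv.swap i j) r = ((Rect.intCount x (rc x i j) : ℤ) : ℚ) := by
    unfold mQ4
    rw [rpm4_eq _ _ hs, rpm4_eq _ _ hs, e1, e2, e3, e4,
      sumP hn x i j _ _ hij hx (Or.inl ⟨rfl, rfl⟩),
      sumP hn (x * Equiv.swap i j) i j _ _ hij hx (Or.inr (by simp)), sum_cho_swap]
    push_cast
    rw [intCount_eq]
    ring
  unfold m4
  rw [this, Int.floor_intCast]
  simp

/-! ### large rectangles meet the markings -/

lemma chi_large {n : ℕ} [NeZero n] (u v : ZMod (2 * n)) (h : n ≤ (v - u).val) (k : ZMod n) :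
    ∃ a, pr a = k ∧ inIco u v a := by
  have h1 := ZMod.val_lt k
  have h2 := ZMod.val_lt u
  have h3 := ZMod.val_lt v
  by_cases hc : inIco u v (lf k)
  · exact ⟨lf k, pr_lf k, hc⟩
  · refine ⟨lf' k, (pr_eq_iff _ _).2 (Or.inr rfl), ?_⟩
    rw [inIco_iff, val_sub_eq, val_sub_eq, lf_val] at hc
    rw [val_sub_eq] at h
    rw [inIco_iff, val_sub_eq, val_sub_eq, lf'_val]
    split_ifs at h hc ⊢ <;> omega

lemma X4_ne {n : ℕ} [NeZero n] (G : GridDiagram n) (r : Rect (2 * n)) (hX : XDisjoint4 G r)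
    (a b : ZMod (2 * n)) (h : pr b = G.Xrow (pr a)) (ha : inIco r.cW r.cE a)
    (hb : inIco r.rS r.rN b) : False := by
  have h1 := hX (pr a)
  unfold X4count at h1
  rw [Finset.sum_eq_zero_iff] at h1
  have h2 := h1 (a, b) (Finset.mem_univ _)
  simp [h, Rect.mult, ha, hb] at h2

lemma start_mem {m : ℕ} [NeZero m] (u v : ZMod m) (h : u ≠ v) : inIco u v u := by
  rw [inIco_iff, sub_self, ZMod.val_zero]
  apply Nat.pos_of_ne_zero
  rw [Ne, ZMod.val_eq_zero, sub_eq_zero]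
  exact h.symm

lemma small_of_disjoint {n : ℕ} [NeZero n] (G : GridDiagram n) (r : Rect (2 * n))
    (h1 : r.cW ≠ r.cE) (h2 : r.rS ≠ r.rN) (hX : XDisjoint4 G r) : small r := by
  constructor
  · by_contra hc
    obtain ⟨k, hk⟩ := G.hX.2 (pr r.rS)
    obtain ⟨a, ha, ha'⟩ := chi_large r.cW r.cE (not_lt.1 hc) k
    exact X4_ne G r hX a r.rS (by rw [ha, hk]) ha' (start_mem _ _ h2)
  · by_contra hc
    obtain ⟨b, hb, hb'⟩ := chi_large r.rS r.rN (not_lt.1 hc) (G.Xrow (pr r.cW))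
    exact X4_ne G r hX r.cW b hb (start_mem _ _ h1) hb'

/-! ### the boundary condition -/

lemma delta_pr {n : ℕ} [NeZero n] (a c : ZMod (2 * n)) :
    (if pr a = pr c then (1 : ℤ) else 0)
      = (if a = c then 1 else 0) + (if a = c + (n : ZMod (2 * n)) then 1 else 0) := by
  have h1 := ZMod.val_lt a
  have h2 := ZMod.val_lt c
  have h3 : c + (n : ZMod (2 * n)) = c - (n : ZMod (2 * n)) := by
    rw [eq_sub_iff_add_eq, add_assoc, ← Nat.cast_add, ← two_mul, ZMod.natCast_self, add_zero]
  have h0 := NeZero.pos n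
  have hv : (n : ZMod (2 * n)).val = n := by
    rw [ZMod.val_natCast, Nat.mod_eq_of_lt (by omega)]
  simp only [h3, zeq, pr_val, val_sub_eq, hv]
  split_ifs <;> omega

lemma delta_mul {m : ℕ} (a b c d : ZMod m) [Decidable ((a, b) = (c, d))] [Decidable (a = c)]
    [Decidable (b = d)] : (if (a, b) = (c, d) then (1 : ℤ) else 0)
      = (if a = c then 1 else 0) * (if b = d then 1 else 0) := by
  by_cases h1 : a = c <;> by_cases h2 : b = d <;> simp [h1, h2]

/-- Kronecker delta -/
def dl {m : ℕ} (a c : ZMod m) : ℤ := if a = c then 1 else 0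

lemma delta_mulC {m : ℕ} (a b c d : ZMod m) [Decidable ((a, b) = (c, d))] :
    (if (a, b) = (c, d) then (1 : ℤ) else 0)
      = dl a c * dl b d := by
  unfold dl
  by_cases h1 : a = c <;> by_cases h2 : b = d <;> simp [h1, h2]

lemma delta_pair {n : ℕ} [NeZero n] (p : ZMod (2 * n) × ZMod (2 * n)) (c d : ZMod (2 * n)) :
    (if p = (c, d) then (1 : ℤ) else 0) + (if p = (c, d + (n : ZMod (2 * n))) then 1 else 0)
      + (if p = (c + (n : ZMod (2 * n)), d) then 1 else 0)
      + (if p = (c + (n : ZMod (2 * n)), d + (n : ZMod (2 * n))) then 1 else 0)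
      = (if (pr p.1, pr p.2) = (pr c, pr d) then 1 else 0) := by
  obtain ⟨a, b⟩ := p
  have e : ∀ {m : ℕ} (a b c d : ZMod m), (if (a, b) = (c, d) then (1 : ℤ) else 0)
      = (if a = c then 1 else 0) * (if b = d then 1 else 0) := by
    intro m a b c d
    by_cases h1 : a = c <;> by_cases h2 : b = d <;> simp [h1, h2]
  simp only [e, delta_pr]
  ring

lemma cornerA_sum {n : ℕ} [NeZero n] (r : Rect (2 * n)) (p : ZMod (2 * n) × ZMod (2 * n)) :
    cornerA r p + cornerA (trN r) p + cornerA (trE r) p + cornerA (trN (trE r)) p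
      = cornerA (prR r) (pr p.1, pr p.2) := by
  obtain ⟨a, b⟩ := p
  have h1 := delta_pair (a, b) r.cE r.rS
  have h2 := delta_pair (a, b) r.cW r.rN
  have h3 := delta_pair (a, b) r.cW r.rS
  have h4 := delta_pair (a, b) r.cE r.rN
  simp only [delta_mulC] at h1 h2 h3 h4
  simp only [cornerA, delta_mulC]
  simp only [trN, trE, prR]
  linear_combination h1 + h2 - h3 - h4

lemma cornerB_eq {m : ℕ} (r : Rect m) (p : ZMod m × ZMod m) : cornerB r p = - cornerA r p := by
  simp only [cornerA, cornerB]; ring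

lemma isRect4_iff {n : ℕ} [NeZero n] (x y : GridState n) (r : Rect (2 * n)) :
    IsRect4From x y r ↔ r.cW ≠ r.cE ∧ r.rS ≠ r.rN ∧
      ∀ k l : ZMod n, cornerA (prR r) (k, l)
        = (if y k = l then 1 else 0) - (if x k = l then 1 else 0) := by
  unfold IsRect4From
  simp only [cornerB_eq, ← neg_add, cornerA_sum, stInd]
  constructor
  · rintro ⟨h1, h2, h3, -⟩
    refine ⟨h1, h2, fun k l => ?_⟩
    have := h3 (lf k, lf l)
    simpa only [pr_lf] using this
  · rintro ⟨h1, h2, h3⟩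
    refine ⟨h1, h2, fun p => h3 _ _, fun p => ?_⟩
    rw [h3]; ring

lemma pr_ne {n : ℕ} [NeZero n] (u v : ZMod (2 * n)) (h : (v - u).val < n) (huv : u ≠ v) :
    pr u ≠ pr v := by
  have h2 := ZMod.val_lt u
  have h3 := ZMod.val_lt v
  rw [Ne, zeq] at huv
  rw [Ne, zeq, pr_val, pr_val]
  rw [val_sub_eq] at h
  split_ifs at h ⊢ <;> omega

lemma isRect4_small {n : ℕ} [NeZero n] (x y : GridState n) (r : Rect (2 * n)) (hs : small r)
    (h : IsRect4From x y r) :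
    pr r.cW ≠ pr r.cE ∧ prR r = rc x (pr r.cW) (pr r.cE)
      ∧ y = x * Equiv.swap (pr r.cW) (pr r.cE) := by
  rw [isRect4_iff] at h
  obtain ⟨h1, h2, h3⟩ := h
  have n1 := pr_ne _ _ hs.1 h1
  have n2 := pr_ne _ _ hs.2 h2
  simp only [cornerA, prR, Prod.mk.injEq] at h3
  have a1 := h3 (pr r.cW) (pr r.rS)
  have a2 := h3 (pr r.cE) (pr r.rN)
  have a3 := h3 (pr r.cE) (pr r.rS)
  have a4 := h3 (pr r.cW) (pr r.rN)
  simp [n1, n2, n1.symm, n2.symm] at a1 a2 a3 a4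
  have b1 : x (pr r.cW) = pr r.rS := by
    by_contra hc; rw [if_neg hc] at a1; split_ifs at a1 <;> omega
  have b2 : x (pr r.cE) = pr r.rN := by
    by_contra hc; rw [if_neg hc] at a2; split_ifs at a2 <;> omega
  have b3 : y (pr r.cE) = pr r.rS := by
    by_contra hc; rw [if_neg hc] at a3; split_ifs at a3 <;> omega
  have b4 : y (pr r.cW) = pr r.rN := by
    by_contra hc; rw [if_neg hc] at a4; split_ifs at a4 <;> omega
  refine ⟨n1, by simp [prR, rc, b1, b2], ?_⟩
  ext1 k
  simp only [Equiv.Perm.mul_apply]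
  by_cases k1 : k = pr r.cW
  · subst k1; simp [b2, b4]
  · by_cases k2 : k = pr r.cE
    · subst k2; simp [b1, b3]
    · have := h3 k (x k)
      simp [k1, k2] at this
      rw [Equiv.swap_apply_of_ne_of_ne k1 k2]
      by_contra hc
      simp [hc] at this

lemma isRect4_of {n : ℕ} [NeZero n] (x : GridState n) (r : Rect (2 * n)) (i j : ZMod n)
    (hij : i ≠ j) (hr : prR r = rc x i j) : IsRect4From x (x * Equiv.swap i j) r := by
  have hx : x i ≠ x j := fun e => hij (x.injective e)
  rw [isRect4_iff]
  have e1 : pr r.cW = i := congrArg Rect.cW hr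
  have e2 : pr r.cE = j := congrArg Rect.cE hr
  have e3 : pr r.rS = x i := congrArg Rect.rS hr
  have e4 : pr r.rN = x j := congrArg Rect.rN hr
  refine ⟨?_, ?_, ?_⟩
  · intro e
    apply hij
    rw [← e1, ← e2, e]
  · intro e
    apply hx
    rw [← e3, ← e4, e]
  · intro k l
    rw [hr]
    simp only [cornerA, rc]
    simp only [Equiv.Perm.mul_apply]
    by_cases k1 : k = i
    · subst k1; simp [hij, eq_comm]
    · by_cases k2 : k = j
      · subst k2; simp [k1, eq_comm]
      · have := Equiv.swap_apply_of_ne_of_ne k1 k2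
        simp [k1, k2, this]

/-- the standard lift of a rectangle -/
def up {n : ℕ} (R : Rect n) : Rect (2 * n) :=
  ⟨lf R.cW, lf R.cW + lf (R.cE - R.cW), lf R.rS, lf R.rS + lf (R.rN - R.rS)⟩

lemma pr_add {n : ℕ} (a b : ZMod (2 * n)) : pr (a + b) = pr a + pr b := by
  simp [pr]

lemma pr_sub {n : ℕ} (a b : ZMod (2 * n)) : pr (a - b) = pr a - pr b := by
  simp [pr]

lemma prR_up {n : ℕ} [NeZero n] (R : Rect n) : prR (up R) = R := by
  simp [prR, up, pr_add, pr_lf]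

lemma small_up {n : ℕ} [NeZero n] (R : Rect n) : small (up R) := by
  simp only [small, up, add_sub_cancel_left, lf_val]
  exact ⟨ZMod.val_lt _, ZMod.val_lt _⟩

lemma normal_up {n : ℕ} [NeZero n] (R : Rect n) : normal4 (up R) := by
  simp only [normal4, up, lf_val]
  exact ⟨ZMod.val_lt _, ZMod.val_lt _⟩

lemma lf_pr {n : ℕ} [NeZero n] (a : ZMod (2 * n)) (h : a.val < n) : lf (pr a) = a := by
  rw [zeq, lf_val, pr_val, if_pos h]

lemma up_prR {n : ℕ} [NeZero n] (r : Rect (2 * n)) (hs : small r) (hn : normal4 r) :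
    up (prR r) = r := by
  obtain ⟨a, b, c, d⟩ := r
  simp only [up, prR, ← pr_sub]
  rw [lf_pr _ hs.1, lf_pr _ hs.2, lf_pr _ hn.1, lf_pr _ hn.2]
  simp

/-! ### the differential in terms of pairs of columns -/

/-- weight of the rectangle from `x` with west column `i` and east column `j` -/
def W {n : ℕ} [NeZero n] (G : GridDiagram n) (x : GridState n) (i j : ZMod n) : Rng n :=
  if i ≠ j ∧ XDisjoint G (rc x i j) then wtB G x (rc x i j) else 0

lemma diff_basis_aux {n : ℕ} [NeZero n] (G : GridDiagram n) (x : GridState n) :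
    (∑ y : GridState n, ∑ r ∈ Finset.univ.filter
        (fun r : Rect (2 * n) => IsRect4From x y r ∧ normal4 r ∧ XDisjoint4 G r),
      (Finsupp.single y (wt4 G x y r) : GC n))
    = ∑ p : ZMod n × ZMod n, Finsupp.single (x * Equiv.swap p.1 p.2) (W G x p.1 p.2) := by
  have hn := one_lt_of_grid G
  have hR : (∑ p : ZMod n × ZMod n,
      (Finsupp.single (x * Equiv.swap p.1 p.2) (W G x p.1 p.2) : GC n))
      = ∑ p ∈ Finset.univ.filter
          (fun p : ZMod n × ZMod n => p.1 ≠ p.2 ∧ XDisjoint G (rc x p.1 p.2)),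
        Finsupp.single (x * Equiv.swap p.1 p.2) (wtB G x (rc x p.1 p.2)) := by
    rw [Finset.sum_filter]
    refine Finset.sum_congr rfl fun p _ => ?_
    unfold W
    split_ifs <;> simp
  rw [hR, Finset.sum_sigma']
  refine Finset.sum_bij' (fun q _ => (pr q.2.cW, pr q.2.cE))
    (fun p _ => ⟨x * Equiv.swap p.1 p.2, up (rc x p.1 p.2)⟩) ?_ ?_ ?_ ?_ ?_
  · rintro ⟨y, r⟩ hq
    simp only [Finset.mem_sigma, Finset.mem_univ, Finset.mem_filter, true_and] at hq ⊢
    obtain ⟨h1, h2, h3⟩ := hq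
    have hs := small_of_disjoint G r h1.1 h1.2.1 h3
    obtain ⟨a1, a2, a3⟩ := isRect4_small x y r hs h1
    refine ⟨a1, fun i => ?_⟩
    rw [← a2, ← X4_eq G r hs, h3]
  · rintro ⟨i, j⟩ hp
    simp only [Finset.mem_sigma, Finset.mem_univ, Finset.mem_filter, true_and] at hp ⊢
    refine ⟨isRect4_of x _ i j hp.1 (prR_up _), normal_up _, fun k => ?_⟩
    rw [X4_eq G _ (small_up _), prR_up, hp.2]
  · rintro ⟨y, r⟩ hq
    simp only [Finset.mem_sigma, Finset.mem_univ, Finset.mem_filter, true_and] at hq ⊢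
    obtain ⟨h1, h2, h3⟩ := hq
    have hs := small_of_disjoint G r h1.1 h1.2.1 h3
    obtain ⟨a1, a2, a3⟩ := isRect4_small x y r hs h1
    rw [← a2, up_prR r hs h2, a3]
  · rintro ⟨i, j⟩ hp
    simp [up, rc, pr_add, pr_lf]
  · rintro ⟨y, r⟩ hq
    simp only [Finset.mem_sigma, Finset.mem_univ, Finset.mem_filter, true_and] at hq ⊢
    obtain ⟨h1, h2, h3⟩ := hq
    have hs := small_of_disjoint G r h1.1 h1.2.1 h3
    obtain ⟨a1, a2, a3⟩ := isRect4_small x y r hs h1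
    rw [a3]
    congr 1
    unfold wt4 wtB
    rw [m4_eq hn x r hs _ _ a1 a2]
    simp only [O4_eq G r hs, a2]

lemma diff4_single {n : ℕ} [NeZero n] (G : GridDiagram n) (x : GridState n) (c : Rng n) :
    diff4 G (Finsupp.single x c)
      = ∑ p : ZMod n × ZMod n,
          Finsupp.single (x * Equiv.swap p.1 p.2) (c * W G x p.1 p.2) := by
  unfold diff4 basisMap
  rw [Finsupp.lsum_single, LinearMap.toSpanSingleton_apply]
  beta_reduce
  rw [diff_basis_aux, Finset.smul_sum]
  refine Finset.sum_congr rfl fun p _ => ?_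
  rw [Finsupp.smul_single, smul_eq_mul]

/-! ## homogeneity -/

/-- exponent vector of the weight of a rectangle -/
def ee {n : ℕ} [NeZero n] (G : GridDiagram n) (x : GridState n) (r : Rect n) :
    Option (ZMod n) →₀ ℕ :=
  Finsupp.equivFunOnFinite.symm fun o => o.elim (Rect.intCount x r) (Ocount G r)

lemma wtB_eq {n : ℕ} [NeZero n] (G : GridDiagram n) (x : GridState n) (r : Rect n) :
    wtB G x r = MvPolynomial.monomial (ee G x r) 1 := by
  rw [MvPolynomial.monomial_eq, Finsupp.prod_fintype _ _ (fun i => pow_zero _),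
    Fintype.prod_option]
  simp [wtB, ee, Vv, vV, mul_comm]

lemma maslovO_step {n : ℕ} [NeZero n] (G : GridDiagram n) (x : GridState n) (i j : ZMod n)
    (h : i ≠ j) : MaslovO G x - MaslovO G (x * Equiv.swap i j)
      = 1 + 2 * (Rect.intCount x (rc x i j) : ℚ) - 2 * ∑ k, (Ocount G (rc x i j) k : ℚ) :=
  maslov_diff (one_lt_of_grid G) G.Orow G.hO x i j h

lemma maslovX_step {n : ℕ} [NeZero n] (G : GridDiagram n) (x : GridState n) (i j : ZMod n)
    (h : i ≠ j) : MaslovX G x - MaslovX G (x * Equiv.swap i j)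
      = 1 + 2 * (Rect.intCount x (rc x i j) : ℚ) - 2 * ∑ k, (Xcount G (rc x i j) k : ℚ) :=
  maslov_diff (one_lt_of_grid G) G.Xrow G.hX x i j h

lemma homog_part {n : ℕ} [NeZero n] (G : GridDiagram n) : MapHomog G G (diff4 G) (-1) 0 := by
  intro z d s hz y k hk
  have hsum : diff4 G z = ∑ x : GridState n, diff4 G (Finsupp.single x (z x)) := by
    rw [← map_sum]
    congr 1
    exact (Finsupp.univ_sum_single z).symm
  rw [hsum, Finsupp.finsetSum_apply, MvPolynomial.coeff_sum] at hk
  obtain ⟨x, -, hk2⟩ := Finset.exists_ne_zero_of_sum_ne_zero hk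
  rw [diff4_single, Finsupp.finsetSum_apply, MvPolynomial.coeff_sum] at hk2
  clear hk
  obtain ⟨⟨i, j⟩, -, hk⟩ := Finset.exists_ne_zero_of_sum_ne_zero hk2
  clear hk2
  rw [Finsupp.single_apply] at hk
  split_ifs at hk with hy
  swap
  · simp at hk
  subst hy
  unfold W at hk
  split_ifs at hk with hc
  swap
  · simp at hk
  dsimp only at hc hk ⊢
  obtain ⟨hij, hX⟩ := hc
  rw [wtB_eq, MvPolynomial.coeff_mul_monomial'] at hk
  split_ifs at hk with hle
  swap
  · simp at hk
  rw [mul_one] at hk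
  obtain ⟨m1, m2⟩ := hz x _ hk
  have f0 : ∀ o, (k o : ℚ) = ((k - ee G x (rc x i j)) o : ℕ) + (ee G x (rc x i j) o : ℕ) := by
    intro o
    rw [← Nat.cast_add, ← Finsupp.add_apply, tsub_add_cancel_of_le hle]
  have f1 : ∀ l : ZMod n, (k (some l) : ℚ)
      = ((k - ee G x (rc x i j)) (some l) : ℕ) + (Ocount G (rc x i j) l : ℚ) := by
    intro l; rw [f0]; simp [ee]
  have f2 : (k none : ℚ)
      = ((k - ee G x (rc x i j)) none : ℕ) + (Rect.intCount x (rc x i j) : ℚ) := by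
    rw [f0]; simp [ee]
  have g1 := maslovO_step G x i j hij
  have g2 := maslovX_step G x i j hij
  have g3 : ∑ k, (Xcount G (rc x i j) k : ℚ) = 0 :=
    Finset.sum_eq_zero fun l _ => by rw [hX l]; simp
  rw [g3] at g2
  unfold Alex at m2 ⊢
  simp only [f1, f2, Finset.sum_add_distrib]
  constructor <;> linarith

/-! ## the square of the differential -/

lemma chi_end {m : ℕ} [NeZero m] (u v : ZMod m) (h : u ≠ v) : chi u v (v - 1) = 1 := by
  have h1 := chi_add u v u (v - 1)
  have h2 : ∀ w : ZMod m, chi w w (v - 1) = 0 := by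
    intro w; simp [chi, inIco_iff]
  have h3 : chi v u (v - 1) = 0 := by
    unfold chi
    rw [if_neg]
    rw [inIco_iff]
    have : v - 1 - v = -1 := by ring
    rw [this, not_lt]
    have h4 := ZMod.val_lt (u - v)
    have h5 : u - v ≠ 0 := sub_ne_zero.2 h
    obtain ⟨k, rfl⟩ : ∃ k, m = k + 1 := ⟨m - 1, by have := NeZero.pos m; omega⟩
    rw [ZMod.val_neg_one]
    omega
  have h4 := kap_or u v u h.symm
  have h5 : kap u u v = 0 := by
    simp [kap]
  rw [h2, h3] at h1
  rcases h4 with h4 | h4 <;> linarith [h4.1, h4.2]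

lemma chi_compl {m : ℕ} [NeZero m] (u v b : ZMod m) (h : u ≠ v) :
    chi u v b + chi v u b = 1 := by
  have h1 := chi_add u v u b
  have h2 : chi u u b = 0 := by simp [chi, inIco_iff]
  have h4 := kap_or u v u h.symm
  have h5 : kap u u v = 0 := by
    simp [kap]
  rcases h4 with h4 | h4 <;> linarith [h4.1, h4.2]

/-- a composite of two steps of the differential -/
def T {n : ℕ} [NeZero n] (G : GridDiagram n) (x : GridState n) (i j k l : ZMod n) : GC n :=
  Finsupp.single (x * Equiv.swap i j * Equiv.swap k l)
    (W G x i j * W G (x * Equiv.swap i j) k l)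

lemma gc_add_self {n : ℕ} (z : GC n) : z + z = 0 := by
  ext1 y
  rw [Finsupp.add_apply]
  exact CharTwo.add_self_eq_zero _

lemma W_self {n : ℕ} [NeZero n] (G : GridDiagram n) (x : GridState n) (i : ZMod n) :
    W G x i i = 0 := by simp [W]

lemma T_self1 {n : ℕ} [NeZero n] (G : GridDiagram n) (x : GridState n) (i k l : ZMod n) :
    T G x i i k l = 0 := by simp [T, W_self]

lemma T_self2 {n : ℕ} [NeZero n] (G : GridDiagram n) (x : GridState n) (i j k : ZMod n) :
    T G x i j k k = 0 := by simp [T, W_self]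

/-- total multiplicity of the two rectangles -/
def tm {n : ℕ} (x : GridState n) (i j k l a b : ZMod n) : ℚ :=
  chi i j a * chi (x i) (x j) b + chi k l a *
    chi ((x * Equiv.swap i j) k) ((x * Equiv.swap i j) l) b

lemma tm_eq {n : ℕ} (x : GridState n) (i j k l a b : ZMod n) :
    tm x i j k l a b = (((rc x i j).mult (a, b) + (rc (x * Equiv.swap i j) k l).mult (a, b) : ℕ)
      : ℚ) := by
  push_cast
  rw [mult_eq, mult_eq]
  rfl

lemma T_zero {n : ℕ} [NeZero n] (G : GridDiagram n) (x : GridState n) (i j k l : ZMod n)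
    (h : (∃ a, ∀ b, 1 ≤ tm x i j k l a b) ∨ (∃ b, ∀ a, 1 ≤ tm x i j k l a b)) :
    T G x i j k l = 0 := by
  by_contra hc
  have hX : XDisjoint G (rc x i j) ∧ XDisjoint G (rc (x * Equiv.swap i j) k l) := by
    by_contra h'
    apply hc
    unfold T W
    rw [not_and_or] at h'
    rcases h' with h' | h' <;> simp [h']
  have key : ∀ a, tm x i j k l a (G.Xrow a) = 0 := by
    intro a
    have h1 := hX.1 a
    have h2 := hX.2 a
    unfold Xcount at h1 h2
    rw [tm_eq, h1, h2]
    simp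
  rcases h with ⟨a, h⟩ | ⟨b, h⟩
  · have := h (G.Xrow a)
    rw [key] at this
    linarith
  · obtain ⟨a, rfl⟩ := G.hX.2 b
    have := h a
    rw [key] at this
    linarith

lemma T_eq {n : ℕ} [NeZero n] (G : GridDiagram n) (x : GridState n)
    (i j k l i' j' k' l' : ZMod n) (hij : i ≠ j) (hkl : k ≠ l) (hij' : i' ≠ j') (hkl' : k' ≠ l')
    (hp : x * Equiv.swap i j * Equiv.swap k l = x * Equiv.swap i' j' * Equiv.swap k' l')
    (hm : ∀ a b, tm x i j k l a b = tm x i' j' k' l' a b) :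
    T G x i j k l = T G x i' j' k' l' := by
  have hm' : ∀ a b, (rc x i j).mult (a, b) + (rc (x * Equiv.swap i j) k l).mult (a, b)
      = (rc x i' j').mult (a, b) + (rc (x * Equiv.swap i' j') k' l').mult (a, b) := by
    intro a b
    have := hm a b
    rw [tm_eq, tm_eq] at this
    exact_mod_cast this
  unfold T
  rw [hp]
  congr 1
  by_cases hX : XDisjoint G (rc x i j) ∧ XDisjoint G (rc (x * Equiv.swap i j) k l)
  · have hX' : XDisjoint G (rc x i' j') ∧ XDisjoint G (rc (x * Equiv.swap i' j') k' l') := by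
      constructor <;> intro a <;>
      · have h0 := hm' a (G.Xrow a)
        have h1 := hX.1 a
        have h2 := hX.2 a
        unfold Xcount at h1 h2 ⊢
        omega
    unfold W
    rw [if_pos ⟨hij, hX.1⟩, if_pos ⟨hkl, hX.2⟩, if_pos ⟨hij', hX'.1⟩, if_pos ⟨hkl', hX'.2⟩]
    simp only [wtB_eq, MvPolynomial.monomial_mul, mul_one]
    congr 2
    have hO : ∀ a, Ocount G (rc x i j) a + Ocount G (rc (x * Equiv.swap i j) k l) a
        = Ocount G (rc x i' j') a + Ocount G (rc (x * Equiv.swap i' j') k' l') a :=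
      fun a => hm' a (G.Orow a)
    ext o
    cases o with
    | some a => simpa [ee] using hO a
    | none =>
      have s1 := maslovO_step G x i j hij
      have s2 := maslovO_step G (x * Equiv.swap i j) k l hkl
      have s3 := maslovO_step G x i' j' hij'
      have s4 := maslovO_step G (x * Equiv.swap i' j') k' l' hkl'
      rw [hp] at s2
      have hs : (∑ a, (Ocount G (rc x i j) a : ℚ))
          + ∑ a, (Ocount G (rc (x * Equiv.swap i j) k l) a : ℚ)
          = (∑ a, (Ocount G (rc x i' j') a : ℚ))
          + ∑ a, (Ocount G (rc (x * Equiv.swap i' j') k' l') a : ℚ) := by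
        rw [← Finset.sum_add_distrib, ← Finset.sum_add_distrib]
        refine Finset.sum_congr rfl fun a _ => ?_
        exact_mod_cast hO a
      have : (Rect.intCount x (rc x i j) : ℚ)
          + (Rect.intCount (x * Equiv.swap i j) (rc (x * Equiv.swap i j) k l) : ℚ)
          = (Rect.intCount x (rc x i' j') : ℚ)
          + (Rect.intCount (x * Equiv.swap i' j') (rc (x * Equiv.swap i' j') k' l') : ℚ) := by
        linarith
      simp only [ee, Finsupp.add_apply, Finsupp.equivFunOnFinite_symm_apply_apply,
        Option.elim_none]
      exact_mod_cast this
  · have hX' : ¬ (XDisjoint G (rc x i' j') ∧ XDisjoint G (rc (x * Equiv.swap i' j') k' l')) := by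
      intro hX'
      apply hX
      constructor <;> intro a <;>
      · have h0 := hm' a (G.Xrow a)
        have h1 := hX'.1 a
        have h2 := hX'.2 a
        unfold Xcount at h1 h2 ⊢
        omega
    have z1 : W G x i j * W G (x * Equiv.swap i j) k l = 0 := by
      unfold W
      rw [not_and_or] at hX
      rcases hX with h | h <;> simp [h]
    have z2 : W G x i' j' * W G (x * Equiv.swap i' j') k' l' = 0 := by
      unfold W
      rw [not_and_or] at hX'
      rcases hX' with h | h <;> simp [h]
    rw [z1, z2]

lemma sw_ne {n : ℕ} (x : GridState n) (i j c : ZMod n) (h1 : c ≠ i) (h2 : c ≠ j) :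
    (x * Equiv.swap i j) c = x c := by
  rw [Equiv.Perm.mul_apply, Equiv.swap_apply_of_ne_of_ne h1 h2]

lemma sw_l {n : ℕ} (x : GridState n) (i j : ZMod n) : (x * Equiv.swap i j) i = x j := by
  simp

lemma sw_r {n : ℕ} (x : GridState n) (i j : ZMod n) : (x * Equiv.swap i j) j = x i := by
  simp

/-! ### vanishing -/

lemma T_same {n : ℕ} [NeZero n] (G : GridDiagram n) (x : GridState n) (i j : ZMod n) :
    T G x i j i j = 0 := by
  by_cases h : i = j
  · subst h; exact T_self1 ..
  apply T_zero
  left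
  refine ⟨i, fun b => ?_⟩
  have := chi_compl (x i) (x j) b (fun e => h (x.injective e))
  rw [tm, sw_l, sw_r, chi_start _ _ h]
  linarith

lemma T_opp {n : ℕ} [NeZero n] (G : GridDiagram n) (x : GridState n) (i j : ZMod n) :
    T G x i j j i = 0 := by
  by_cases h : i = j
  · subst h; exact T_self1 ..
  apply T_zero
  right
  refine ⟨x i, fun a => ?_⟩
  have := chi_compl i j a h
  rw [tm, sw_l, sw_r, chi_start (x i) (x j) (fun e => h (x.injective e))]
  linarith

section triple
variable {n : ℕ} [NeZero n] (G : GridDiagram n) (x : GridState n) (i j c : ZMod n)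
  (hij : i ≠ j) (hic : i ≠ c) (hjc : j ≠ c)

lemma A_tm (hic : i ≠ c) (hjc : j ≠ c) (a b : ZMod n) : tm x i j i c a b
    = chi i j a * chi (x i) (x j) b + chi i c a * chi (x j) (x c) b := by
  rw [tm, sw_l, sw_ne x i j c hic.symm hjc.symm]

lemma B_tm (hic : i ≠ c) (hjc : j ≠ c) (a b : ZMod n) : tm x i j c i a b
    = chi i j a * chi (x i) (x j) b + chi c i a * chi (x c) (x j) b := by
  rw [tm, sw_l, sw_ne x i j c hic.symm hjc.symm]

lemma C_tm (hic : i ≠ c) (hjc : j ≠ c) (a b : ZMod n) : tm x i j j c a b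
    = chi i j a * chi (x i) (x j) b + chi j c a * chi (x i) (x c) b := by
  rw [tm, sw_r, sw_ne x i j c hic.symm hjc.symm]

lemma D_tm (hic : i ≠ c) (hjc : j ≠ c) (a b : ZMod n) : tm x i j c j a b
    = chi i j a * chi (x i) (x j) b + chi c j a * chi (x c) (x i) b := by
  rw [tm, sw_r, sw_ne x i j c hic.symm hjc.symm]

lemma A_zero (hij : i ≠ j) (hic : i ≠ c) (hjc : j ≠ c) (h : kap (x i) (x j) (x c) = 1) :
    T G x i j i c = 0 := by
  apply T_zero
  left
  refine ⟨i, fun b => ?_⟩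
  rw [A_tm x i j c hic hjc, chi_start _ _ hij, chi_start _ _ hic]
  linarith [chi_add (x i) (x j) (x c) b, chi_nonneg (x i) (x c) b]

lemma B_zero (hij : i ≠ j) (hic : i ≠ c) (hjc : j ≠ c) (h : kap c i j = 1) :
    T G x i j c i = 0 := by
  apply T_zero
  right
  refine ⟨x j - 1, fun a => ?_⟩
  rw [B_tm x i j c hic hjc, chi_end _ _ (fun e => hij (x.injective e)),
    chi_end _ _ (fun e => hjc (x.injective e).symm)]
  linarith [chi_add c i j a, chi_nonneg c j a]

lemma C_zero (hij : i ≠ j) (hic : i ≠ c) (hjc : j ≠ c) (h : kap i j c = 1) :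
    T G x i j j c = 0 := by
  apply T_zero
  right
  refine ⟨x i, fun a => ?_⟩
  rw [C_tm x i j c hic hjc, chi_start _ _ (fun e => hij (x.injective e)),
    chi_start _ _ (fun e => hic (x.injective e))]
  linarith [chi_add i j c a, chi_nonneg i c a]

lemma D_zero (hij : i ≠ j) (hic : i ≠ c) (hjc : j ≠ c) (h : kap (x c) (x i) (x j) = 1) :
    T G x i j c j = 0 := by
  apply T_zero
  left
  refine ⟨j - 1, fun b => ?_⟩
  rw [D_tm x i j c hic hjc, chi_end _ _ hij, chi_end _ _ hjc.symm]
  linarith [chi_add (x c) (x i) (x j) b, chi_nonneg (x c) (x j) b]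

/-! ### pairing -/

lemma perm3 (x : GridState n) (p q : Equiv.Perm (ZMod n)) (p' q' : Equiv.Perm (ZMod n))
    (h : p * q = p' * q') : x * p * q = x * p' * q' := by
  rw [mul_assoc, mul_assoc, h]

lemma swap_id1 (hij : i ≠ j) (hic : i ≠ c) (hjc : j ≠ c) :
    Equiv.swap i j * Equiv.swap i c = Equiv.swap i c * Equiv.swap c j := by
  ext1 a
  simp only [Equiv.Perm.mul_apply, Equiv.swap_apply_def]
  split_ifs <;> simp_all

lemma swap_id2 (hij : i ≠ j) (hic : i ≠ c) (hjc : j ≠ c) :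
    Equiv.swap i j * Equiv.swap i c = Equiv.swap j c * Equiv.swap i j := by
  ext1 a
  simp only [Equiv.Perm.mul_apply, Equiv.swap_apply_def]
  split_ifs <;> simp_all

lemma AC (hij : i ≠ j) (hic : i ≠ c) (hjc : j ≠ c) (h1 : kap i c j = 0)
    (h2 : kap (x i) (x j) (x c) = 0) : T G x i j i c = T G x i c c j := by
  refine T_eq G x _ _ _ _ _ _ _ _ hij hic hic hjc.symm
    (perm3 _ _ _ _ _ (swap_id1 i j c hij hic hjc)) fun a b => ?_
  rw [A_tm x i j c hic hjc, C_tm x i c j hij hjc.symm]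
  have e1 := chi_add i c j a
  have e2 := chi_add (x i) (x j) (x c) b
  rw [h1] at e1
  rw [h2] at e2
  linear_combination (- chi (x i) (x j) b) * e1 + chi i c a * e2

lemma AB (hij : i ≠ j) (hic : i ≠ c) (hjc : j ≠ c) (h1 : kap i j c = 0)
    (h2 : kap (x i) (x j) (x c) = 0) : T G x i j i c = T G x j c i j := by
  refine T_eq G x _ _ _ _ _ _ _ _ hij hic hjc hij
    (perm3 _ _ _ _ _ (swap_id2 i j c hij hic hjc)) fun a b => ?_
  rw [A_tm x i j c hic hjc, B_tm x j c i hij.symm hic.symm]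
  have e1 := chi_add i j c a
  have e2 := chi_add (x i) (x j) (x c) b
  rw [h1] at e1
  rw [h2] at e2
  linear_combination (- chi (x j) (x c) b) * e1 + chi i j a * e2

lemma CD (hij : i ≠ j) (hic : i ≠ c) (hjc : j ≠ c) (h1 : kap i j c = 0)
    (h2 : kap (x i) (x j) (x c) = 0) : T G x i j j c = T G x j c i c := by
  refine T_eq G x _ _ _ _ _ _ _ _ hij hjc hjc hic
    (perm3 _ _ _ _ _ ?_) fun a b => ?_
  · have := swap_id1 j i c hij.symm hjc hic
    rw [Equiv.swap_comm j i, Equiv.swap_comm c i] at this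
    exact this
  rw [C_tm x i j c hic hjc, D_tm x j c i hij.symm hic.symm]
  have e1 := chi_add i j c a
  have e2 := chi_add (x i) (x j) (x c) b
  rw [h1] at e1
  rw [h2] at e2
  linear_combination (chi (x i) (x j) b) * e1 - chi j c a * e2

lemma BD (hij : i ≠ j) (hic : i ≠ c) (hjc : j ≠ c) (h1 : kap c i j = 0)
    (h2 : kap (x i) (x c) (x j) = 0) : T G x i j c i = T G x c j i j := by
  refine T_eq G x _ _ _ _ _ _ _ _ hij hic.symm hjc.symm hij
    (perm3 _ _ _ _ _ ?_) fun a b => ?_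
  · have := swap_id2 i j c hij hic hjc
    rw [Equiv.swap_comm i c, Equiv.swap_comm j c] at this
    exact this
  rw [B_tm x i j c hic hjc, D_tm x c j i hic.symm hij.symm]
  have e1 := chi_add c i j a
  have e2 := chi_add (x i) (x c) (x j) b
  rw [h1] at e1
  rw [h2] at e2
  linear_combination (chi (x c) (x j) b) * e1 - chi i j a * e2

end triple

/-- guard -/
def Dist {n : ℕ} (i j c : ZMod n) : Prop := i ≠ j ∧ i ≠ c ∧ j ≠ c

/-- guarded first family -/
def Q1 {n : ℕ} [NeZero n] (G : GridDiagram n) (x : GridState n) (i j c : ZMod n) : GC n :=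
  if Dist i j c ∧ kap i c j = 0 ∧ kap (x i) (x j) (x c) = 0 then T G x i j i c else 0

/-- guarded second family -/
def Q2 {n : ℕ} [NeZero n] (G : GridDiagram n) (x : GridState n) (i j c : ZMod n) : GC n :=
  if Dist i j c ∧ kap i j c = 0 ∧ kap (x i) (x j) (x c) = 0 then T G x i j i c else 0

/-- guarded third family -/
def Q3 {n : ℕ} [NeZero n] (G : GridDiagram n) (x : GridState n) (i j c : ZMod n) : GC n :=
  if Dist i j c ∧ kap i j c = 0 ∧ kap (x i) (x j) (x c) = 0 then T G x i j j c else 0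

/-- guarded fourth family -/
def Q4 {n : ℕ} [NeZero n] (G : GridDiagram n) (x : GridState n) (i j c : ZMod n) : GC n :=
  if Dist i j c ∧ kap c i j = 0 ∧ kap (x i) (x c) (x j) = 0 then T G x i j c i else 0

lemma kap_alt {m : ℕ} [NeZero m] (a b c : ZMod m) (h : b ≠ c) : kap a c b = 1 - kap a b c := by
  rcases kap_or a b c h with h | h <;> linarith [h.1, h.2]

lemma kap_01 {m : ℕ} [NeZero m] (a b c : ZMod m) (h : b ≠ c) : kap a b c = 0 ∨ kap a b c = 1 := by
  rcases kap_or a b c h with h | h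
  · exact Or.inl h.1
  · exact Or.inr h.1

lemma A_split {n : ℕ} [NeZero n] (G : GridDiagram n) (x : GridState n) (i j c : ZMod n) :
    T G x i j i c = Q1 G x i j c + Q2 G x i j c := by
  by_cases hd : Dist i j c
  · obtain ⟨hij, hic, hjc⟩ := hd
    have hd : Dist i j c := ⟨hij, hic, hjc⟩
    have a1 := kap_alt i j c hjc
    rcases kap_01 (x i) (x j) (x c) (fun e => hjc (x.injective e)) with h | h
    · rcases kap_01 i j c hjc with h' | h' <;> simp [Q1, Q2, hd, h, h', a1]
    · rw [A_zero G x i j c hij hic hjc h]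
      simp [Q1, Q2, h]
  · have : T G x i j i c = 0 := by
      unfold Dist at hd
      by_cases h1 : i = j
      · subst h1; exact T_self1 ..
      by_cases h2 : i = c
      · subst h2; exact T_self2 ..
      have h3 : j = c := by tauto
      subst h3; exact T_same ..
    simp [this, Q1, Q2, hd]

lemma C_split {n : ℕ} [NeZero n] (G : GridDiagram n) (x : GridState n) (i j c : ZMod n) :
    T G x i j j c = Q1 G x i c j + Q3 G x i j c := by
  by_cases hd : Dist i j c
  · obtain ⟨hij, hic, hjc⟩ := hd
    have hd : Dist i j c := ⟨hij, hic, hjc⟩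
    have hd' : Dist i c j := ⟨hic, hij, hjc.symm⟩
    have hx : x j ≠ x c := fun e => hjc (x.injective e)
    have a1 := kap_alt (x i) (x j) (x c) hx
    rcases kap_01 i j c hjc with h | h
    · rcases kap_01 (x i) (x j) (x c) hx with h' | h'
      · simp [Q1, Q3, hd, h, h', a1]
      · have := AC G x i c j hic hij hjc.symm h (by rw [a1, h']; norm_num)
        simp [Q1, Q3, hd, hd', h, h', a1, this]
    · rw [C_zero G x i j c hij hic hjc h]
      simp [Q1, Q3, h]
  · have hd' : ¬ Dist i c j := by
      unfold Dist at hd ⊢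
      intro h
      exact hd ⟨h.2.1, h.1, h.2.2.symm⟩
    have : T G x i j j c = 0 := by
      unfold Dist at hd
      by_cases h1 : i = j
      · subst h1; exact T_self1 ..
      by_cases h2 : j = c
      · subst h2; exact T_self2 ..
      have h3 : i = c := by tauto
      subst h3; exact T_opp ..
    simp [this, Q1, Q3, hd, hd']

lemma B_split {n : ℕ} [NeZero n] (G : GridDiagram n) (x : GridState n) (i j c : ZMod n) :
    T G x i j c i = Q2 G x c i j + Q4 G x i j c := by
  by_cases hd : Dist i j c
  · obtain ⟨hij, hic, hjc⟩ := hd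
    have hd : Dist i j c := ⟨hij, hic, hjc⟩
    have hd' : Dist c i j := ⟨hic.symm, hjc.symm, hij⟩
    have hx : x j ≠ x c := fun e => hjc (x.injective e)
    have hx' : x i ≠ x c := fun e => hic (x.injective e)
    have a1 := kap_alt (x i) (x j) (x c) hx
    rw [kap_rot (x i) (x j) (x c) hx hx'] at a1
    rcases kap_01 c i j hij with h | h
    · rcases kap_01 (x c) (x i) (x j) (fun e => hij (x.injective e)) with h' | h'
      · have := AB G x c i j hic.symm hjc.symm hij h h'
        simp [Q2, Q4, hd', h, h', a1, this]
      · simp [Q2, Q4, hd, h, h', a1]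
    · rw [B_zero G x i j c hij hic hjc h]
      simp [Q2, Q4, h]
  · have hd' : ¬ Dist c i j := by
      unfold Dist at hd ⊢
      intro h
      exact hd ⟨h.2.2, h.1.symm, h.2.1.symm⟩
    have : T G x i j c i = 0 := by
      unfold Dist at hd
      by_cases h1 : i = j
      · subst h1; exact T_self1 ..
      by_cases h2 : i = c
      · subst h2; exact T_self2 ..
      have h3 : j = c := by tauto
      subst h3; exact T_opp ..
    simp [this, Q2, Q4, hd, hd']

lemma D_split {n : ℕ} [NeZero n] (G : GridDiagram n) (x : GridState n) (i j c : ZMod n) :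
    T G x i j c j = Q3 G x c i j + Q4 G x c j i := by
  by_cases hd : Dist i j c
  · obtain ⟨hij, hic, hjc⟩ := hd
    have hd' : Dist c i j := ⟨hic.symm, hjc.symm, hij⟩
    have hd'' : Dist c j i := ⟨hjc.symm, hic.symm, hij.symm⟩
    have a1 := kap_alt i j c hjc
    rw [kap_rot i j c hjc hic] at a1
    rcases kap_01 (x c) (x i) (x j) (fun e => hij (x.injective e)) with h | h
    · rcases kap_01 c i j hij with h' | h'
      · have := CD G x c i j hic.symm hjc.symm hij h' h
        simp [Q3, Q4, hd', h, h', a1, this]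
      · have := BD G x c j i hjc.symm hic.symm hij.symm (by rw [a1, h']; norm_num) h
        simp [Q3, Q4, hd'', h, h', a1, this]
    · rw [D_zero G x i j c hij hic hjc h]
      simp [Q3, Q4, h]
  · have hd' : ¬ Dist c i j := by
      unfold Dist at hd ⊢
      intro h
      exact hd ⟨h.2.2, h.1.symm, h.2.1.symm⟩
    have hd'' : ¬ Dist c j i := by
      unfold Dist at hd ⊢
      intro h
      exact hd ⟨h.2.2.symm, h.2.1.symm, h.1.symm⟩
    have : T G x i j c j = 0 := by
      unfold Dist at hd
      by_cases h1 : i = j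
      · subst h1; exact T_self1 ..
      by_cases h2 : j = c
      · subst h2; exact T_self2 ..
      have h3 : i = c := by tauto
      subst h3; exact T_same ..
    simp [this, Q3, Q4, hd', hd'']

/-! ### assembling -/

lemma s_acb {α M : Type*} [Fintype α] [AddCommMonoid M] (f : α → α → α → M) :
    ∑ i, ∑ j, ∑ c, f i c j = ∑ i, ∑ j, ∑ c, f i j c :=
  Finset.sum_congr rfl fun _ _ => Finset.sum_comm

lemma s_bac {α M : Type*} [Fintype α] [AddCommMonoid M] (f : α → α → α → M) :
    ∑ i, ∑ j, ∑ c, f j i c = ∑ i, ∑ j, ∑ c, f i j c := Finset.sum_comm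

lemma s_cab {α M : Type*} [Fintype α] [AddCommMonoid M] (f : α → α → α → M) :
    ∑ i, ∑ j, ∑ c, f c i j = ∑ i, ∑ j, ∑ c, f i j c := by
  rw [← s_bac f, ← s_acb (fun i j c => f j i c)]

lemma s_cba {α M : Type*} [Fintype α] [AddCommMonoid M] (f : α → α → α → M) :
    ∑ i, ∑ j, ∑ c, f c j i = ∑ i, ∑ j, ∑ c, f i j c := by
  rw [← s_acb f, ← s_cab (fun i j c => f i c j)]

lemma triple_sum {n : ℕ} [NeZero n] (G : GridDiagram n) (x : GridState n) :
    ∑ i, ∑ j, ∑ c, (T G x i j i c + T G x i j c i + T G x i j j c + T G x i j c j) = 0 := by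
  simp only [A_split, C_split, B_split, D_split, Finset.sum_add_distrib]
  rw [s_acb (Q1 G x), s_cab (Q2 G x), s_cab (Q3 G x), s_cba (Q4 G x)]
  have h1 := gc_add_self (∑ i, ∑ j, ∑ c, Q1 G x i j c)
  have h2 := gc_add_self (∑ i, ∑ j, ∑ c, Q2 G x i j c)
  have h3 := gc_add_self (∑ i, ∑ j, ∑ c, Q3 G x i j c)
  have h4 := gc_add_self (∑ i, ∑ j, ∑ c, Q4 G x i j c)
  generalize (∑ i, ∑ j, ∑ c, Q1 G x i j c) = s1 at *
  generalize (∑ i, ∑ j, ∑ c, Q2 G x i j c) = s2 at *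
  generalize (∑ i, ∑ j, ∑ c, Q3 G x i j c) = s3 at *
  generalize (∑ i, ∑ j, ∑ c, Q4 G x i j c) = s4 at *
  have e : s1 + s2 + (s2 + s4) + (s1 + s3) + (s3 + s4)
      = (s1 + s1) + (s2 + s2) + (s3 + s3) + (s4 + s4) := by abel
  rw [e, h1, h2, h3, h4]
  simp

/-- disjointness of pairs -/
def Off {n : ℕ} (p q : ZMod n × ZMod n) : Prop :=
  p.1 ≠ p.2 ∧ q.1 ≠ q.2 ∧ p.1 ≠ q.1 ∧ p.1 ≠ q.2 ∧ p.2 ≠ q.1 ∧ p.2 ≠ q.2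

lemma Off_symm {n : ℕ} (p q : ZMod n × ZMod n) (h : Off p q) : Off q p := by
  unfold Off at *; tauto

lemma T_comm {n : ℕ} [NeZero n] (G : GridDiagram n) (x : GridState n) (i j k l : ZMod n)
    (h : Off (i, j) (k, l)) : T G x i j k l = T G x k l i j := by
  obtain ⟨h1, h2, h3, h4, h5, h6⟩ := h
  dsimp only at *
  refine T_eq G x _ _ _ _ _ _ _ _ h1 h2 h2 h1 (perm3 _ _ _ _ _ ?_) fun a b => ?_
  · ext1 a
    simp only [Equiv.Perm.mul_apply, Equiv.swap_apply_def]
    split_ifs <;> simp_all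
  · rw [tm, tm, sw_ne x i j k h3.symm h5.symm, sw_ne x i j l h4.symm h6.symm,
      sw_ne x k l i h3 h4, sw_ne x k l j h5 h6]
    ring

lemma off_sum {n : ℕ} [NeZero n] (G : GridDiagram n) (x : GridState n) :
    ∑ p : ZMod n × ZMod n, ∑ q : ZMod n × ZMod n,
      (if Off p q then T G x p.1 p.2 q.1 q.2 else 0) = 0 := by
  rw [← Fintype.sum_prod_type' (f := fun p q : ZMod n × ZMod n =>
    if Off p q then T G x p.1 p.2 q.1 q.2 else 0)]
  refine Finset.sum_involution (fun t _ => (t.2, t.1)) ?_ ?_ ?_ ?_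
  · rintro ⟨p, q⟩ -
    dsimp only
    by_cases h : Off p q
    · rw [if_pos h, if_pos (Off_symm _ _ h), T_comm G x _ _ _ _ h]
      exact gc_add_self _
    · rw [if_neg h, if_neg (fun h' => h (Off_symm _ _ h')), add_zero]
  · rintro ⟨p, q⟩ - hne he
    dsimp only at hne
    rw [Prod.mk.injEq] at he
    apply hne
    rw [if_neg]
    intro h
    exact h.2.2.1 (congrArg Prod.fst he.1).symm
  · intros; simp
  · intros; rfl

lemma pair_split {n : ℕ} [NeZero n] {M : Type*} [AddCommMonoid M] (i j : ZMod n) (hij : i ≠ j)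
    (g : ZMod n × ZMod n → M) (h0 : ∀ k, g (k, k) = 0) (h1 : g (i, j) = 0) (h2 : g (j, i) = 0) :
    ∑ q, g q = (∑ c, (g (i, c) + g (c, i) + g (j, c) + g (c, j)))
      + ∑ q, if Off (i, j) q then g q else 0 := by
  have e : ∀ k l, g (k, l) = (if k = i then g (i, l) else 0) + (if l = i then g (k, i) else 0)
      + (if k = j then g (j, l) else 0) + (if l = j then g (k, j) else 0)
      + (if Off (i, j) (k, l) then g (k, l) else 0) := by
    intro k l
    by_cases hkl : k = l
    · subst hkl
      have : ¬ Off (i, j) (k, k) := fun h => h.2.1 rfl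
      by_cases k1 : k = i
      · subst k1; simp [h0, this, hij]
      · by_cases k2 : k = j
        · subst k2; simp [h0, this, k1]
        · simp [k1, k2, this, h0]
    · by_cases hO : Off (i, j) (k, l)
      · obtain ⟨-, -, a1, a2, a3, a4⟩ := id hO
        dsimp only at a1 a2 a3 a4
        simp [hO, a1.symm, a2.symm, a3.symm, a4.symm]
      · by_cases k1 : k = i
        · subst k1
          by_cases l2 : l = j
          · subst l2; simp [h1, hO, hij, hij.symm]
          · have : l ≠ k := fun e => hkl e.symm
            simp [hO, hij, l2, this]
        · by_cases k2 : k = j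
          · subst k2
            by_cases l1 : l = i
            · subst l1; simp [h2, hO, hij, hij.symm]
            · have : l ≠ k := fun e => hkl e.symm
              simp [hO, k1, l1, this]
          · by_cases l1 : l = i
            · subst l1; simp [hO, k1, k2, hij]
            · by_cases l2 : l = j
              · subst l2; simp [hO, k1, k2, l1]
              · exact absurd ⟨hij, hkl, Ne.symm k1, Ne.symm l1, Ne.symm k2, Ne.symm l2⟩ hO
  rw [Fintype.sum_prod_type, Fintype.sum_prod_type]
  conv_lhs => enter [2, k, 2, l]; rw [e]
  simp only [Finset.sum_add_distrib]
  congr 1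
  have u1 : ∀ t : ZMod n, ∑ k : ZMod n, ∑ l : ZMod n, (if k = t then g (t, l) else 0)
      = ∑ c, g (t, c) := by
    intro t
    rw [Finset.sum_comm]
    simp
  have u2 : ∀ t : ZMod n, ∑ k : ZMod n, ∑ l : ZMod n, (if l = t then g (k, t) else 0)
      = ∑ c, g (c, t) := by
    intro t
    simp
  rw [u1, u1, u2, u2]

lemma sq_zero {n : ℕ} [NeZero n] (G : GridDiagram n) : diff4 G ∘ₗ diff4 G = 0 := by
  apply Finsupp.lhom_ext
  intro x c
  have hc : (Finsupp.single x c : GC n) = c • Finsupp.single x 1 := by simp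
  rw [LinearMap.zero_apply, hc, map_smul, LinearMap.comp_apply]
  have key : diff4 G (diff4 G (Finsupp.single x 1)) = 0 := by
    rw [diff4_single, map_sum]
    simp only [one_mul, diff4_single]
    change ∑ p : ZMod n × ZMod n, ∑ q : ZMod n × ZMod n, T G x p.1 p.2 q.1 q.2 = 0
    have hp : ∀ p : ZMod n × ZMod n, ∑ q : ZMod n × ZMod n, T G x p.1 p.2 q.1 q.2
        = (∑ c, (T G x p.1 p.2 p.1 c + T G x p.1 p.2 c p.1 + T G x p.1 p.2 p.2 c
            + T G x p.1 p.2 c p.2))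
          + ∑ q : ZMod n × ZMod n, if Off p q then T G x p.1 p.2 q.1 q.2 else 0 := by
      rintro ⟨i, j⟩
      by_cases hij : i = j
      · subst hij
        simp [T_self1]
      · exact pair_split i j hij (fun q => T G x i j q.1 q.2) (fun k => T_self2 G x i j k)
          (T_same G x i j) (T_opp G x i j)
    simp only [hp]
    rw [Finset.sum_add_distrib, off_sum, add_zero, Fintype.sum_prod_type]
    exact triple_sum G x
  rw [key, smul_zero]

/-- The endomorphism `∂₄•` of `GC•(𝔾₄)` is homogeneous of degree
`(−1, 0)` with respect to the (Maslov, Alexander) bigrading, and `∂₄• ∘ ∂₄• = 0`. -/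
theorem statement4 (n : ℕ) [NeZero n] (G : GridDiagram n) :
    MapHomog G G (diff4 G) (-1) 0 ∧ diff4 G ∘ₗ diff4 G = 0 := by
  exact ⟨homog_part G, sq_zero G⟩

end GridHomology
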